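/- arXiv:2411.04145 — 5 statements merged into one kernel-verified Lean document; each statement's English description precedes it below -/
import Mathlib

section
/- Let h : ℝ² → ℝ be a smooth function whose support is contained in the open unit disk 𝔻, let c₁, c₂ be nonzero real constants, and let n be an integer such that c₁ e^{−i n (arcsin s − π/2)} + c₂ e^{i n (arcsin s − π/2)} ≠ 0 for all s ∈ (0, 1). Define g_n(s) := (V_w h)_n(arcsin s) / (c₁ e^{−i n (arcsin s − π/2)} + c₂ e^{i n (arcsin s − π/2)}) for s ∈ (0, 1). Then for every r with 0 < r < 1, h_n(r) = −(1/(π r)) [ ∫_r^1 g_n'(s) · (s/r + √(s²/r² − 1))^{−|n|} / √(s²/r² − 1) ds − ∫_0^r g_n'(s) · U_{|n|−1}(s/r) ds ], where U_k denotes the degree-k Chebyshev polynomial of the second kind evaluated as a polynomial at real arguments, with the convention U_{−1} = 0. -/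
open Real MeasureTheory Set

noncomputable section

/-- The unit vector at polar angle `θ`. -/
def Phi (θ : ℝ) : ℝ × ℝ := (Real.cos θ, Real.sin θ)

/-- Rotation of a vector by 90° counterclockwise. -/
def perp (w : ℝ × ℝ) : ℝ × ℝ := (-w.2, w.1)

/-- Euclidean dot product on `ℝ × ℝ`. -/
def dot (a b : ℝ × ℝ) : ℝ := a.1 * b.1 + a.2 * b.2

/-- The open unit disk in the plane. -/
def unitDisk : Set (ℝ × ℝ) := {x | x.1 ^ 2 + x.2 ^ 2 < 1}

/-- The closed unit disk in the plane. -/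
def closedUnitDisk : Set (ℝ × ℝ) := {x | x.1 ^ 2 + x.2 ^ 2 ≤ 1}

/-- The unit circle in the plane. -/
def unitCircle : Set (ℝ × ℝ) := {x | x.1 ^ 2 + x.2 ^ 2 = 1}

/-- The Radon transform of a scalar function. -/
def radon (h : ℝ × ℝ → ℝ) (s θ : ℝ) : ℝ :=
  ∫ t : ℝ, h (s • Phi θ + t • Phi (θ + π / 2))

/-- The weighted V-line transform of a scalar function, with weights `c₁, c₂`. -/
def Vw (c₁ c₂ : ℝ) (h : ℝ × ℝ → ℝ) (φ ψ : ℝ) : ℝ :=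
  c₁ * (∫ t in Ioi (0 : ℝ), h (Phi φ + t • Phi (π + φ - ψ))) +
  c₂ * (∫ t in Ioi (0 : ℝ), h (Phi φ + t • Phi (π + φ + ψ)))

/-- The `n`-th (complex) Fourier coefficient of a function of the angular variable. -/
def fourierCoeff' (g : ℝ → ℝ) (n : ℤ) : ℂ :=
  (1 / (2 * (π : ℂ))) * ∫ φ in (0 : ℝ)..(2 * π), (g φ : ℂ) * Complex.exp (-Complex.I * n * φ)

/-- The integral of `e^{inθ} / (z - R cos θ)` over a period, where `z = R (w + w⁻¹) / 2` with
`w` in the unit disk. -/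
lemma integral_exp_div_sub_cos (n : ℕ) {R : ℝ} (hR : R ≠ 0) {w z : ℂ} (hw0 : w ≠ 0)
    (hw : ‖w‖ < 1) (hz : z = R * (w + w⁻¹) / 2) :
    ∫ θ in (0 : ℝ)..(2 * π), Complex.exp (Complex.I * n * θ) / (z - R * Complex.cos θ) =
      2 * π * (2 * w ^ (n + 1) / (R * (1 - w ^ 2))) := by
  have hwinv : 1 < ‖w⁻¹‖ := by
    rw [norm_inv]
    exact (one_lt_inv₀ (norm_pos_iff.2 hw0)).2 hw
  have hRC : (R : ℂ) ≠ 0 := by exact_mod_cast hR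
  have hne : ∀ ζ : ℂ, ‖ζ‖ ≤ 1 → ζ - w⁻¹ ≠ 0 := by
    intro ζ hζ h0
    rw [sub_eq_zero] at h0
    rw [h0] at hζ
    linarith
  have hcauchy : (∮ ζ in C(0, 1), (ζ - w)⁻¹ • (ζ ^ n / (ζ - w⁻¹))) =
      (2 * π * Complex.I : ℂ) • (w ^ n / (w - w⁻¹)) := by
    apply DiffContOnCl.circleIntegral_sub_inv_smul
    · apply DifferentiableOn.diffContOnCl
      intro ζ hζ
      rw [closure_ball _ one_ne_zero] at hζ
      have h1 := hne ζ (by simpa using hζ)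
      exact DifferentiableAt.differentiableWithinAt (by fun_prop (disch := assumption))
    · simpa using hw
  rw [circleIntegral] at hcauchy
  have hInt : ∀ θ : ℝ, Complex.exp (Complex.I * n * θ) / (z - R * Complex.cos θ) =
      (-(2 / (R * Complex.I))) * (deriv (circleMap 0 1) θ •
        ((circleMap 0 1 θ - w)⁻¹ • (circleMap 0 1 θ ^ n / (circleMap 0 1 θ - w⁻¹)))) := by
    intro θ
    rw [deriv_circleMap]
    have e1 : Complex.exp (Complex.I * n * θ) = circleMap 0 1 θ ^ n := by
      simp only [circleMap, zero_add, Complex.ofReal_one, one_mul, ← Complex.exp_nat_mul]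
      congr 1; ring
    have e2 : Complex.cos θ = (circleMap 0 1 θ + (circleMap 0 1 θ)⁻¹) / 2 := by
      simp only [circleMap, zero_add, Complex.ofReal_one, one_mul, ← Complex.exp_neg, Complex.cos]
      congr 3; ring
    have e3 : ‖circleMap 0 1 θ‖ = 1 := by simp
    rw [e1, e2, hz]
    generalize circleMap 0 1 θ = ζ at e3
    have hζ0 : ζ ≠ 0 := by
      rw [← norm_pos_iff, e3]; exact one_pos
    have h1 := hne ζ e3.le
    have h2 : ζ - w ≠ 0 := by
      intro h; rw [sub_eq_zero] at h; rw [h] at e3; linarith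
    have h3 : (R * (w + w⁻¹) / 2 - R * ((ζ + ζ⁻¹) / 2) : ℂ) =
        -(R / (2 * ζ)) * ((ζ - w) * (ζ - w⁻¹)) := by
      field_simp
      ring
    rw [h3]
    simp only [smul_eq_mul]
    field_simp
  rw [intervalIntegral.integral_congr (fun θ _ => hInt θ), intervalIntegral.integral_const_mul,
    hcauchy, smul_eq_mul]
  have h4 : w - w⁻¹ ≠ 0 := hne w hw.le
  have h5 : 1 - w ^ 2 ≠ 0 := by
    intro h; apply h4; field_simp; linear_combination -h
  have h6 : w - w⁻¹ = -(1 - w ^ 2) / w := by field_simp; ring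
  rw [h6]
  field_simp
  rw [pow_succ]

lemma integral_inv_sq_mul_cos_sq_add_sq {ρ ε : ℝ} (hρ : 0 < ρ) (hε : 0 < ε) :
    ∫ θ in (0 : ℝ)..(2 * π), 1 / (ρ ^ 2 * cos θ ^ 2 + ε ^ 2) =
      2 * π / (ε * √(ε ^ 2 + ρ ^ 2)) := by
  set q := √(ε ^ 2 + ρ ^ 2) with hq
  have hq2 : q ^ 2 = ε ^ 2 + ρ ^ 2 := Real.sq_sqrt (by positivity)
  have hqε : ε < q := by rw [hq]; exact Real.lt_sqrt_of_sq_lt (by nlinarith)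
  have hqρ : q < ε + ρ := by
    rw [hq]; apply (Real.sqrt_lt' (by positivity)).2; nlinarith
  set y := (ε - q) / ρ with hy
  have hy0 : y < 0 := div_neg_of_neg_of_pos (by linarith) hρ
  have hy1 : -1 < y := by rw [hy, lt_div_iff₀ hρ]; linarith
  have hyC : (y : ℂ) ≠ 0 := by exact_mod_cast hy0.ne
  have hρC : (ρ : ℂ) ≠ 0 := by exact_mod_cast hρ.ne'
  have hyeq : ρ * (y ^ 2 - 1) = 2 * ε * y := by
    rw [hy]; field_simp; nlinarith
  have key := integral_exp_div_sub_cos 0 hρ.ne' (w := Complex.I * y) (z := Complex.I * ε)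
    (mul_ne_zero Complex.I_ne_zero hyC) (by
      rw [norm_mul, Complex.norm_I, one_mul, Complex.norm_real, Real.norm_eq_abs, abs_lt]
      exact ⟨hy1, by linarith⟩) (by
      have h' : (ρ * (y ^ 2 - 1) : ℂ) = 2 * ε * y := by exact_mod_cast hyeq
      rw [mul_inv, Complex.inv_I]
      field_simp
      linear_combination -h')
  have hD : ∀ θ : ℝ, 0 < ρ ^ 2 * cos θ ^ 2 + ε ^ 2 := fun θ => by positivity
  have hne : ∀ θ : ℝ, Complex.I * ε - ρ * Complex.cos θ ≠ 0 := by
    intro θ h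
    have := congrArg Complex.im h
    simp [← Complex.ofReal_cos] at this
    exact hε.ne' this
  have hcong : ∀ θ : ℝ, 1 / (ρ ^ 2 * cos θ ^ 2 + ε ^ 2) =
      (-(1 / ε)) * (Complex.exp (Complex.I * (0 : ℕ) * θ) /
        (Complex.I * ε - ρ * Complex.cos θ)).im := by
    intro θ
    have := hD θ
    rw [← Complex.ofReal_cos, Complex.div_im]
    generalize cos θ = c at this ⊢
    simp [Complex.normSq_apply]
    field_simp
  have hInt : IntervalIntegrable (fun θ : ℝ => Complex.exp (Complex.I * (0 : ℕ) * θ) /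
        (Complex.I * ε - ρ * Complex.cos θ)) volume 0 (2 * π) := by
    apply Continuous.intervalIntegrable
    exact Continuous.div (by fun_prop) (by fun_prop) hne
  have him := Complex.imCLM.intervalIntegral_comp_comm hInt
  simp only [Complex.imCLM_apply] at him
  rw [intervalIntegral.integral_congr (fun θ _ => hcong θ), intervalIntegral.integral_const_mul,
    him, key]
  have h1 : (2 * π * (2 * (Complex.I * y) ^ (0 + 1) / (ρ * (1 - (Complex.I * y) ^ 2))) : ℂ) =
      ((2 * π * (2 * y / (ρ * (1 + y ^ 2))) : ℝ) : ℂ) * Complex.I := by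
    push_cast
    rw [mul_pow Complex.I _ 2, Complex.I_sq]
    ring
  rw [h1, Complex.im_ofReal_mul, Complex.I_im]
  have hy2 : ρ * (1 + y ^ 2) = - 2 * y * q := by
    rw [hy]; field_simp; nlinarith
  rw [hy2]
  have := hy0.ne
  have : q ≠ 0 := by linarith
  field_simp

/-- The angular mean of the kernel `(ε² - q²) / (q² + ε²)²` is the planar Poisson kernel. -/
lemma integral_kernel_mul_cos {ρ ε : ℝ} (hρ : 0 < ρ) (hε : 0 < ε) :
    ∫ θ in (0 : ℝ)..(2 * π), (ε ^ 2 - (ρ * cos θ) ^ 2) / ((ρ * cos θ) ^ 2 + ε ^ 2) ^ 2 =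
      2 * π * ε / ((ε ^ 2 + ρ ^ 2) * √(ε ^ 2 + ρ ^ 2)) := by
  have hD : ∀ θ : ℝ, 0 < ρ ^ 2 * cos θ ^ 2 + ε ^ 2 := fun θ => by positivity
  have hE : 0 < ρ ^ 2 + ε ^ 2 := by positivity
  have hderiv : ∀ θ ∈ uIcc 0 (2 * π), HasDerivAt
      (fun θ => sin θ * cos θ / (ρ ^ 2 * cos θ ^ 2 + ε ^ 2))
      (((ρ ^ 2 + 2 * ε ^ 2) * cos θ ^ 2 - ε ^ 2) / (ρ ^ 2 * cos θ ^ 2 + ε ^ 2) ^ 2) θ := by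
    intro θ _
    have h1 := ((hasDerivAt_sin θ).mul (hasDerivAt_cos θ)).div
      ((((hasDerivAt_cos θ).pow 2).const_mul (ρ ^ 2)).add_const (ε ^ 2)) (hD θ).ne'
    refine h1.congr_deriv ?_
    have hs : sin θ ^ 2 = 1 - cos θ ^ 2 := by
      have := sin_sq_add_cos_sq θ
      linarith
    simp only [Pi.mul_apply, Pi.pow_apply]
    congr 1
    push_cast
    ring_nf
    rw [hs]
    ring
  have hcont : Continuous fun θ : ℝ =>
      ((ρ ^ 2 + 2 * ε ^ 2) * cos θ ^ 2 - ε ^ 2) / (ρ ^ 2 * cos θ ^ 2 + ε ^ 2) ^ 2 :=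
    Continuous.div (by fun_prop) (by fun_prop) fun θ => (pow_pos (hD θ) 2).ne'
  have hcont' : Continuous fun θ : ℝ => 1 / (ρ ^ 2 * cos θ ^ 2 + ε ^ 2) :=
    Continuous.div (by fun_prop) (by fun_prop) fun θ => (hD θ).ne'
  have hFTC := intervalIntegral.integral_eq_sub_of_hasDerivAt hderiv (hcont.intervalIntegrable _ _)
  have hsplit : ∀ θ : ℝ, (ε ^ 2 - (ρ * cos θ) ^ 2) / ((ρ * cos θ) ^ 2 + ε ^ 2) ^ 2 =
      (ε ^ 2 / (ρ ^ 2 + ε ^ 2)) * (1 / (ρ ^ 2 * cos θ ^ 2 + ε ^ 2)) +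
      (-(ρ ^ 2 / (ρ ^ 2 + ε ^ 2))) *
        (((ρ ^ 2 + 2 * ε ^ 2) * cos θ ^ 2 - ε ^ 2) / (ρ ^ 2 * cos θ ^ 2 + ε ^ 2) ^ 2) := by
    intro θ
    have := (hD θ).ne'
    rw [mul_pow]
    field_simp
    ring
  rw [intervalIntegral.integral_congr (fun θ _ => hsplit θ), intervalIntegral.integral_add
    ((hcont'.intervalIntegrable _ _).const_mul _) ((hcont.intervalIntegrable _ _).const_mul _),
    intervalIntegral.integral_const_mul, intervalIntegral.integral_const_mul, hFTC,
    integral_inv_sq_mul_cos_sq_add_sq hρ hε]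
  simp only [sin_two_pi, sin_zero]
  have : 0 < √(ε ^ 2 + ρ ^ 2) := by positivity
  field_simp
  ring

/-- The Poisson kernel of the upper half space at height one, as a density on the plane. -/
def planarPoisson (w : ℂ) : ℝ := (2 * π)⁻¹ * ((1 + ‖w‖ ^ 2) * √(1 + ‖w‖ ^ 2))⁻¹

lemma planarPoisson_nonneg (w : ℂ) : 0 ≤ planarPoisson w := by
  unfold planarPoisson; positivity

lemma tendsto_inv_sqrt_one_add_sq :
    Filter.Tendsto (fun x : ℝ => (√(1 + x ^ 2))⁻¹) Filter.atTop (nhds 0) := by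
  apply Filter.Tendsto.inv_tendsto_atTop
  apply Filter.tendsto_atTop_mono (f := fun x : ℝ => x) _ Filter.tendsto_id
  intro x
  exact Real.le_sqrt_of_sq_le (by linarith)

lemma integral_planarPoisson : ∫ w, planarPoisson w = 1 := by
  have h1 : ∫ x in Ioi (0 : ℝ), x * ((1 + x ^ 2) * √(1 + x ^ 2))⁻¹ = 1 := by
    have := integral_Ioi_of_hasDerivAt_of_nonneg' (a := 0) (l := 0)
      (g := fun x : ℝ => -(√(1 + x ^ 2))⁻¹)
      (g' := fun x : ℝ => x * ((1 + x ^ 2) * √(1 + x ^ 2))⁻¹) ?_ ?_ ?_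
    · rw [this]; simp
    · intro x _
      have hpos : 0 < 1 + x ^ 2 := by positivity
      have hs : 0 < √(1 + x ^ 2) := by positivity
      have hd := (((((hasDerivAt_id x).pow 2).const_add 1).sqrt (by simp; positivity)).inv
        (by simp; positivity)).neg
      refine hd.congr_deriv ?_
      have h2 : √(1 + x ^ 2) ^ 2 = 1 + x ^ 2 := Real.sq_sqrt hpos.le
      simp only [Pi.pow_apply, id]
      field_simp
      rw [h2]
      push_cast
      ring
    · intro x hx
      have : 0 < x := hx
      positivity
    · simpa using tendsto_inv_sqrt_one_add_sq.neg
  rw [← Complex.integral_comp_polarCoord_symm]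
  have h2 : ∀ p ∈ polarCoord.target, p.1 • planarPoisson (Complex.polarCoord.symm p) =
      (p.1 * ((1 + p.1 ^ 2) * √(1 + p.1 ^ 2))⁻¹) * (fun _ : ℝ => (2 * π)⁻¹) p.2 := by
    intro p _
    simp only [planarPoisson, Complex.norm_polarCoord_symm, sq_abs, smul_eq_mul]
    ring
  rw [setIntegral_congr_fun polarCoord.open_target.measurableSet h2, polarCoord_target]
  rw [Measure.volume_eq_prod, setIntegral_prod_mul
    (fun x : ℝ => x * ((1 + x ^ 2) * √(1 + x ^ 2))⁻¹) (fun _ => (2 * π)⁻¹), h1]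
  have : (0 : ℝ) ≤ π + π := by positivity
  simp [this]
  field_simp
  norm_num

lemma tendsto_integral_planarPoisson {f : ℂ → ℂ} (hf : Continuous f) (hfi : Integrable f)
    (x₀ : ℂ) :
    Filter.Tendsto (fun c : ℝ => ∫ w, (c ^ 2 * planarPoisson (c • (x₀ - w))) • f w)
      Filter.atTop (nhds (f x₀)) := by
  have := tendsto_integral_comp_smul_smul_of_integrable' (μ := (volume : Measure ℂ))
    planarPoisson_nonneg integral_planarPoisson ?_ hfi hf.continuousAt (x₀ := x₀)
  · simpa only [Complex.finrank_real_complex] using this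
  · rw [Complex.finrank_real_complex]
    have h0 := (tendsto_inv_sqrt_one_add_sq.comp (tendsto_norm_cobounded_atTop (E := ℂ))).const_mul
      (2 * π)⁻¹
    rw [mul_zero] at h0
    refine squeeze_zero (fun w => mul_nonneg (by positivity) (planarPoisson_nonneg w))
      (fun w => ?_) h0
    have h1 : ‖w‖ ^ 2 * (1 + ‖w‖ ^ 2)⁻¹ ≤ 1 := by
      rw [← div_eq_mul_inv, div_le_one (by positivity)]; linarith
    have h2 : 0 ≤ (2 * π)⁻¹ * (√(1 + ‖w‖ ^ 2))⁻¹ := by positivity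
    simp only [planarPoisson, Function.comp_apply, mul_inv (1 + ‖w‖ ^ 2)]
    nlinarith

lemma intervalIntegral_integral_swap_of_forall_eq_zero {X : Type*} [NormedAddCommGroup X]
    [ProperSpace X] [MeasureSpace X] [BorelSpace X] [SecondCountableTopology X]
    [SFinite (volume : Measure X)] [IsFiniteMeasureOnCompacts (volume : Measure X)]
    {F : ℝ → X → ℂ} (hF : Continuous (Function.uncurry F)) {R : ℝ}
    (hzero : ∀ θ x, R ≤ ‖x‖ → F θ x = 0) (a b : ℝ) :
    ∫ θ in a..b, ∫ x, F θ x = ∫ x, ∫ θ in a..b, F θ x := by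
  apply intervalIntegral_integral_swap
  rw [← Measure.restrict_univ (μ := (volume : Measure X)), Measure.prod_restrict]
  have hK : IntegrableOn (Function.uncurry F) (uIcc a b ×ˢ Metric.closedBall (0 : X) R)
      ((volume : Measure ℝ).prod (volume : Measure X)) :=
    hF.continuousOn.integrableOn_compact (isCompact_uIcc.prod (isCompact_closedBall 0 R))
  refine (hK.of_forall_sdiff_eq_zero (t := uIcc a b ×ˢ univ)
    (measurableSet_uIcc.prod MeasurableSet.univ) ?_).mono_set
    (Set.prod_mono uIoc_subset_uIcc (subset_refl _))
  rintro ⟨θ, x⟩ ⟨h1, h2⟩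
  apply hzero
  by_contra hlt
  apply h2
  simp only [mem_prod, mem_univ, and_true] at h1
  exact ⟨h1, by simpa using (not_le.1 hlt).le⟩

/-- The kernel `q / (q² + ε²)` of the regularized Hilbert transform. -/
def conjPoisson (ε q : ℝ) : ℝ := q / (q ^ 2 + ε ^ 2)

/-- The derivative of `conjPoisson ε`. -/
def conjPoissonDeriv (ε q : ℝ) : ℝ := (ε ^ 2 - q ^ 2) / (q ^ 2 + ε ^ 2) ^ 2

/-- The Fourier coefficient of the regularized Hilbert kernel along the circle of radius `r`. -/
def hilbertKernel (n : ℤ) (r ε s : ℝ) : ℂ :=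
  ∫ θ in (0 : ℝ)..(2 * π), Complex.exp (Complex.I * n * θ) * conjPoisson ε (s - r * cos θ)

lemma hasDerivAt_conjPoisson {ε : ℝ} (hε : 0 < ε) (q : ℝ) :
    HasDerivAt (conjPoisson ε) (conjPoissonDeriv ε q) q := by
  have h := (hasDerivAt_id q).div (((hasDerivAt_id q).pow 2).add_const (ε ^ 2))
    (by simp only [Pi.pow_apply, id]; positivity)
  refine h.congr_deriv ?_
  simp only [Pi.pow_apply, id, conjPoissonDeriv]
  congr 1
  push_cast
  ring

lemma continuous_conjPoisson {ε : ℝ} (hε : 0 < ε) : Continuous (conjPoisson ε) :=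
  continuous_iff_continuousAt.2 fun q => (hasDerivAt_conjPoisson hε q).continuousAt

lemma continuous_conjPoissonDeriv {ε : ℝ} (hε : 0 < ε) : Continuous (conjPoissonDeriv ε) := by
  unfold conjPoissonDeriv
  exact Continuous.div (by fun_prop) (by fun_prop) fun q => by positivity

lemma integral_cos_sub_eq (F : ℝ → ℝ) (β : ℝ) :
    ∫ θ in (0 : ℝ)..(2 * π), F (cos (θ - β)) = ∫ θ in (0 : ℝ)..(2 * π), F (cos θ) := by
  have hper : Function.Periodic (fun θ => F (cos θ)) (2 * π) := fun θ => by
    simp only [cos_add_two_pi]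
  rw [intervalIntegral.integral_comp_sub_right (fun θ => F (cos θ)) β]
  have := hper.intervalIntegral_add_eq (-β) 0
  rw [zero_add] at this
  rw [← this]
  congr 1 <;> ring

lemma planarPoisson_eq_integral {c : ℝ} (hc : 0 < c) (r : ℝ) {w : ℂ} (hw : w ≠ r) :
    c ^ 2 * planarPoisson (c • ((r : ℂ) - w)) = (4 * π ^ 2)⁻¹ *
      ∫ θ in (0 : ℝ)..(2 * π),
        conjPoissonDeriv c⁻¹ ((Complex.exp (-(θ * Complex.I)) * w).re - r * cos θ) := by
  have hρ : 0 < ‖w - r‖ := norm_pos_iff.2 (sub_ne_zero.2 hw)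
  have harg : ∀ θ : ℝ, (Complex.exp (-(θ * Complex.I)) * w).re - r * cos θ =
      ‖w - r‖ * cos (θ - Complex.arg (w - r)) := by
    intro θ
    have h1 : (Complex.exp (-(θ * Complex.I)) * w).re - r * cos θ =
        (Complex.exp (-(θ * Complex.I)) * (w - r)).re := by
      rw [mul_sub, Complex.sub_re, mul_comm (Complex.exp (-(θ * Complex.I))) (r : ℂ),
        Complex.re_ofReal_mul, show (-(θ * Complex.I) : ℂ) = ((-θ : ℝ) : ℂ) * Complex.I by
          push_cast; ring, Complex.exp_ofReal_mul_I_re, cos_neg]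
    rw [h1]
    conv_lhs => rw [← Complex.norm_mul_exp_arg_mul_I (w - r)]
    rw [mul_left_comm, ← Complex.exp_add, Complex.re_ofReal_mul,
      show (-(θ * Complex.I) + Complex.arg (w - r) * Complex.I : ℂ) =
        ((Complex.arg (w - r) - θ : ℝ) : ℂ) * Complex.I by push_cast; ring,
      Complex.exp_ofReal_mul_I_re, ← cos_neg, neg_sub]
  rw [intervalIntegral.integral_congr (fun θ _ => congrArg (conjPoissonDeriv c⁻¹) (harg θ)),
    integral_cos_sub_eq (fun x => conjPoissonDeriv c⁻¹ (‖w - r‖ * x))]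
  have := integral_kernel_mul_cos hρ (inv_pos.2 hc)
  unfold conjPoissonDeriv planarPoisson
  rw [this, norm_smul, norm_sub_rev, Real.norm_eq_abs, abs_of_pos hc]
  generalize ‖w - r‖ = ρ at hρ
  have hs : √(1 + (c * ρ) ^ 2) = c * √(c⁻¹ ^ 2 + ρ ^ 2) := by
    rw [show 1 + (c * ρ) ^ 2 = c ^ 2 * (c⁻¹ ^ 2 + ρ ^ 2) by field_simp,
      Real.sqrt_mul (by positivity), Real.sqrt_sq hc.le]
  rw [hs]
  have : 0 < √(c⁻¹ ^ 2 + ρ ^ 2) := by positivity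
  have h3 : c⁻¹ ^ 2 + ρ ^ 2 = (1 + (c * ρ) ^ 2) / c ^ 2 := by field_simp
  generalize √(c⁻¹ ^ 2 + ρ ^ 2) = S at this
  rw [h3]
  field_simp
  norm_num

section Radon

variable {f : ℂ → ℂ} {n : ℤ} {G G' : ℝ → ℂ}

lemma integrable_of_eq_zero_outside (hf : Continuous f) (hzero : ∀ z, 1 ≤ ‖z‖ → f z = 0) :
    Integrable f :=
  hf.integrable_of_hasCompactSupport <|
    HasCompactSupport.intro (isCompact_closedBall (0 : ℂ) 1) fun z hz =>
      hzero z (by simpa using (not_le.1 fun h => hz (by simpa using h)).le)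

lemma integral_radial_projection (hf : Continuous f) (hzero : ∀ z, 1 ≤ ‖z‖ → f z = 0)
    (k : ℝ → ℝ) (hk : Continuous k) :
    ∫ z, (k z.re : ℂ) * f z =
      ∫ s in (-1 : ℝ)..1, k s * ∫ t : ℝ, f (s + t * Complex.I) := by
  rw [← Complex.volume_preserving_equiv_real_prod.symm.integral_comp
    Complex.measurableEquivRealProd.symm.measurableEmbedding, Measure.volume_eq_prod,
    integral_prod]
  · simp only [Complex.measurableEquivRealProd_symm_apply]
    have h1 : ∀ s : ℝ, (∫ t : ℝ, (k s : ℂ) * f ⟨s, t⟩) = k s * ∫ t : ℝ, f (s + t * Complex.I) := by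
      intro s
      rw [integral_const_mul]
      simp only [Complex.mk_eq_add_mul_I]
    simp only [h1]
    rw [intervalIntegral.integral_of_le (by norm_num)]
    symm
    apply setIntegral_eq_integral_of_forall_compl_eq_zero
    intro s hs
    have hs1 : 1 ≤ |s| := by
      by_contra hlt
      have := abs_lt.1 (not_le.1 hlt)
      exact hs ⟨this.1, this.2.le⟩
    have : ∀ t : ℝ, f (s + t * Complex.I) = 0 := fun t => by
      apply hzero
      have := Complex.abs_re_le_norm (s + t * Complex.I)
      simp at this
      linarith
    simp [this]
  · have hi : Integrable (fun z : ℂ => (k z.re : ℂ) * f z) :=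
      integrable_of_eq_zero_outside (by fun_prop) fun z hz => by rw [hzero z hz, mul_zero]
    exact (Complex.volume_preserving_equiv_real_prod.symm.integrable_comp_emb
      Complex.measurableEquivRealProd.symm.measurableEmbedding).2 hi

lemma integral_poisson_eq_integral_hilbertKernel (hf : Continuous f)
    (hzero : ∀ z, 1 ≤ ‖z‖ → f z = 0)
    (hcov : ∀ (α : ℝ) z, f (Complex.exp (α * Complex.I) * z) =
      Complex.exp (Complex.I * n * α) * f z)
    (hGdef : ∀ s : ℝ, G s = ∫ t : ℝ, f (s + t * Complex.I))
    (hG : ∀ s, HasDerivAt G (G' s) s) (hG' : Continuous G') {c : ℝ} (hc : 0 < c) (r : ℝ) :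
    ∫ w, (c ^ 2 * planarPoisson (c • ((r : ℂ) - w))) • f w =
      -(4 * π ^ 2 : ℂ)⁻¹ * ∫ s in (-1 : ℝ)..1, G' s * hilbertKernel n r c⁻¹ s := by
  have hε : 0 < c⁻¹ := inv_pos.2 hc
  have hk := continuous_conjPoissonDeriv hε
  have hq := continuous_conjPoisson hε
  have hG1 : ∀ s : ℝ, 1 ≤ |s| → G s = 0 := by
    intro s hs
    have : ∀ t : ℝ, f (s + t * Complex.I) = 0 := fun t => by
      apply hzero
      have := Complex.abs_re_le_norm (s + t * Complex.I)
      simp at this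
      linarith
    simp [hGdef, this]
  set F : ℝ → ℂ → ℂ := fun θ w =>
    (conjPoissonDeriv c⁻¹ ((Complex.exp (-(θ * Complex.I)) * w).re - r * cos θ) : ℂ) * f w with hF
  have hFc : Continuous (Function.uncurry F) := by
    simp only [hF, Function.uncurry_def]
    fun_prop
  have step1 : ∫ w, (c ^ 2 * planarPoisson (c • ((r : ℂ) - w))) • f w =
      (4 * π ^ 2 : ℂ)⁻¹ * ∫ w, ∫ θ in (0 : ℝ)..(2 * π), F θ w := by
    rw [← integral_const_mul]
    apply integral_congr_ae
    have hae : ∀ᵐ w : ℂ, w ≠ r := by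
      simp [ae_iff]
    filter_upwards [hae] with w hw
    simp only [hF]
    rw [intervalIntegral.integral_mul_const, intervalIntegral.integral_ofReal,
      planarPoisson_eq_integral hc r hw, Complex.real_smul]
    push_cast
    ring
  have step2 : ∀ θ : ℝ, ∫ w, F θ w = Complex.exp (Complex.I * n * θ) *
      -∫ s in (-1 : ℝ)..1, G' s * conjPoisson c⁻¹ (s - r * cos θ) := by
    intro θ
    have hrot := (rotation (Circle.exp θ)).measurePreserving.integral_comp
      (rotation (Circle.exp θ)).toHomeomorph.measurableEmbedding (F θ)
    rw [← hrot]
    have h1 : ∀ z : ℂ, F θ (rotation (Circle.exp θ) z) = Complex.exp (Complex.I * n * θ) *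
        ((conjPoissonDeriv c⁻¹ (z.re - r * cos θ) : ℂ) * f z) := by
      intro z
      simp only [hF, rotation_apply, Circle.coe_exp]
      rw [hcov, ← mul_assoc (Complex.exp (-(θ * Complex.I))), ← Complex.exp_add, neg_add_cancel,
        Complex.exp_zero, one_mul]
      ring
    simp only [h1]
    rw [integral_const_mul, integral_radial_projection hf hzero
      (fun s => conjPoissonDeriv c⁻¹ (s - r * cos θ)) (by fun_prop)]
    congr 1
    have hparts := intervalIntegral.integral_mul_deriv_eq_deriv_mul (a := -1) (b := 1)
      (u := G) (u' := G') (v := fun s => (conjPoisson c⁻¹ (s - r * cos θ) : ℂ))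
      (v' := fun s => (conjPoissonDeriv c⁻¹ (s - r * cos θ) : ℂ))
      (fun s _ => hG s)
      (fun s _ => ((hasDerivAt_conjPoisson hε _).comp_sub_const s (r * cos θ)).ofReal_comp)
      (hG'.intervalIntegrable _ _) ((by fun_prop : Continuous _).intervalIntegrable _ _)
    rw [hG1 1 (by simp), hG1 (-1) (by simp)] at hparts
    simp only [zero_mul, sub_zero, zero_sub] at hparts
    rw [← hparts]
    congr 1
    ext s
    rw [hGdef]
    ring
  rw [step1, ← intervalIntegral_integral_swap_of_forall_eq_zero hFc (R := 1)
    (fun θ x hx => by simp only [hF]; rw [hzero x hx, mul_zero])]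
  simp only [step2]
  simp only [mul_neg, intervalIntegral.integral_neg, neg_mul, hilbertKernel]
  simp only [← intervalIntegral.integral_const_mul]
  rw [intervalIntegral_intervalIntegral_swap]
  · congr! 5
    ring
  · apply IntegrableOn.mono_set (t := uIcc 0 (2 * π) ×ˢ uIcc (-1) 1) _
      (Set.prod_mono uIoc_subset_uIcc uIoc_subset_uIcc)
    apply ContinuousOn.integrableOn_compact (isCompact_uIcc.prod isCompact_uIcc)
    apply Continuous.continuousOn
    simp only [Function.uncurry_def]
    fun_prop

end Radon

lemma exp_I_mul_int_mul_add_two_pi (n : ℤ) (θ : ℝ) :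
    Complex.exp (Complex.I * n * (θ + 2 * π : ℝ)) = Complex.exp (Complex.I * n * θ) := by
  rw [show (Complex.I * n * ((θ + 2 * π : ℝ) : ℂ) : ℂ) =
    Complex.I * n * θ + n * (2 * π * Complex.I) by push_cast; ring, Complex.exp_add,
    Complex.exp_int_mul_two_pi_mul_I, mul_one]

lemma exp_I_mul_int_mul_pi_mul_self (n : ℤ) :
    Complex.exp (Complex.I * n * π) * Complex.exp (Complex.I * n * π) = 1 := by
  rw [← Complex.exp_add, ← Complex.exp_int_mul_two_pi_mul_I n]
  congr 1
  ring

lemma hilbertKernel_neg_left (n : ℤ) (r ε s : ℝ) :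
    hilbertKernel (-n) r ε s = hilbertKernel n r ε s := by
  unfold hilbertKernel
  have h := intervalIntegral.integral_comp_sub_left (a := 0) (b := 2 * π)
    (fun θ : ℝ => Complex.exp (Complex.I * n * θ) * conjPoisson ε (s - r * cos θ)) (2 * π)
  rw [sub_self, sub_zero] at h
  rw [← h]
  apply intervalIntegral.integral_congr
  intro θ _
  simp only [cos_two_pi_sub]
  congr 1
  rw [sub_eq_neg_add, exp_I_mul_int_mul_add_two_pi]
  congr 1
  push_cast
  ring

lemma hilbertKernel_natAbs (n : ℤ) (r ε s : ℝ) :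
    hilbertKernel n r ε s = hilbertKernel (n.natAbs : ℤ) r ε s := by
  rcases Int.natAbs_eq n with h | h
  · rw [← h]
  · conv_lhs => rw [h]
    rw [hilbertKernel_neg_left]

lemma hilbertKernel_neg_right (n : ℤ) (r ε s : ℝ) :
    hilbertKernel n r ε (-s) = -Complex.exp (Complex.I * n * π) * hilbertKernel n r ε s := by
  unfold hilbertKernel
  have hper : Function.Periodic (fun θ : ℝ =>
      Complex.exp (Complex.I * n * θ) * conjPoisson ε (-s - r * cos θ)) (2 * π) := fun θ => by
    simp only [exp_I_mul_int_mul_add_two_pi, cos_add_two_pi]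
  have h := hper.intervalIntegral_add_eq 0 π
  rw [zero_add] at h
  have h2 := intervalIntegral.integral_comp_add_right (a := 0) (b := 2 * π)
    (fun θ : ℝ => Complex.exp (Complex.I * n * θ) * conjPoisson ε (-s - r * cos θ)) π
  rw [zero_add, add_comm (2 * π) π] at h2
  rw [h, ← h2, ← intervalIntegral.integral_const_mul]
  apply intervalIntegral.integral_congr
  intro θ _
  simp only [cos_add_pi]
  have h3 : conjPoisson ε (-s - r * -cos θ) = -conjPoisson ε (s - r * cos θ) := by
    unfold conjPoisson
    rw [← neg_div]
    congr 1 <;> ring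
  rw [h3]
  push_cast
  rw [mul_add, Complex.exp_add]
  ring

lemma continuous_hilbertKernel (n : ℤ) (r : ℝ) {ε : ℝ} (hε : 0 < ε) :
    Continuous (hilbertKernel n r ε) := by
  have := continuous_conjPoisson hε
  unfold hilbertKernel
  apply intervalIntegral.continuous_parametric_intervalIntegral_of_continuous'
  simp only [Function.uncurry_def]
  fun_prop

/-- The Joukowsky map sends the lower half of the punctured unit disk onto the upper half plane. -/
lemma exists_joukowsky_eq {r ε : ℝ} (hr : 0 < r) (hε : 0 < ε) (s : ℝ) :
    ∃ w : ℂ, w ≠ 0 ∧ ‖w‖ < 1 ∧ w.im < 0 ∧ (s + Complex.I * ε : ℂ) = r * (w + w⁻¹) / 2 := by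
  have hrC : (r : ℂ) ≠ 0 := by exact_mod_cast hr.ne'
  set z : ℂ := s + Complex.I * ε with hz
  have hzim : z.im = ε := by simp [hz]
  obtain ⟨d, hd⟩ := IsAlgClosed.exists_pow_nat_eq ((z / r) ^ 2 - 1) (n := 2) two_pos
  have key : ∀ w : ℂ, w ≠ 0 → z = r * (w + w⁻¹) / 2 → ‖w‖ < 1 → w.im < 0 := by
    intro w hw0 hw hw1
    have h1 := congrArg Complex.im hw
    have hns : 0 < Complex.normSq w := Complex.normSq_pos.2 hw0
    have hns1 : Complex.normSq w < 1 := by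
      rw [Complex.normSq_eq_norm_sq]; nlinarith [norm_nonneg w]
    rw [hzim, mul_div_assoc, Complex.im_ofReal_mul, Complex.div_ofNat_im, Complex.add_im,
      Complex.inv_im] at h1
    by_contra hcon
    push Not at hcon
    have h2 : w.im ≤ w.im / Complex.normSq w := by
      rw [le_div_iff₀ hns]; nlinarith
    have h3 : w.im + -w.im / Complex.normSq w ≤ 0 := by rw [neg_div]; linarith
    have h4 : r * ((w.im + -w.im / Complex.normSq w) / 2) ≤ 0 :=
      mul_nonpos_of_nonneg_of_nonpos hr.le (by linarith)
    linarith
  have hw0 : z / r + d ≠ 0 := by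
    intro h
    have : (z / r + d) * (z / r - d) = 1 := by linear_combination -hd
    rw [h, zero_mul] at this
    exact zero_ne_one this
  have hinv : (z / r + d)⁻¹ = z / r - d := by
    apply inv_eq_of_mul_eq_one_right
    linear_combination -hd
  have hjou : z = r * ((z / r + d) + (z / r + d)⁻¹) / 2 := by
    rw [hinv]; field_simp; ring
  generalize z / r + d = w at hw0 hjou
  rcases lt_trichotomy ‖w‖ 1 with h | h | h
  · exact ⟨w, hw0, h, key w hw0 hjou h, hjou⟩
  · exfalso
    have h1 := congrArg Complex.im hjou
    rw [Complex.inv_eq_conj h, Complex.add_conj, ← Complex.ofReal_mul, hzim] at h1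
    simp at h1
    exact hε.ne' h1
  · have hlt : ‖w⁻¹‖ < 1 := by rw [norm_inv]; exact inv_lt_one_of_one_lt₀ h
    have hj : z = r * (w⁻¹ + w⁻¹⁻¹) / 2 := by rw [inv_inv, add_comm]; exact hjou
    exact ⟨w⁻¹, inv_ne_zero hw0, hlt, key _ (inv_ne_zero hw0) hj hlt, hj⟩

lemma hilbertKernel_eq {r ε s : ℝ} (hr : 0 < r) (hε : 0 < ε) (n : ℕ) {w : ℂ} (hw0 : w ≠ 0)
    (hw1 : ‖w‖ < 1) (hw : (s + Complex.I * ε : ℂ) = r * (w + w⁻¹) / 2) :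
    hilbertKernel n r ε s = π * (2 * w ^ (n + 1) / (r * (1 - w ^ 2)) +
      2 * (starRingEnd ℂ w) ^ (n + 1) / (r * (1 - (starRingEnd ℂ w) ^ 2))) := by
  have h1 := integral_exp_div_sub_cos n hr.ne' hw0 hw1 hw
  have hw' : (s - Complex.I * ε : ℂ) =
      r * (starRingEnd ℂ w + (starRingEnd ℂ w)⁻¹) / 2 := by
    have := congrArg (starRingEnd ℂ) hw
    simpa [sub_eq_add_neg, map_ofNat] using this
  have h2 := integral_exp_div_sub_cos n hr.ne'
    ((map_ne_zero (starRingEnd ℂ)).2 hw0) (by simpa using hw1) hw'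
  have hne : ∀ (η : ℝ), η ≠ 0 → ∀ θ : ℝ, (s + Complex.I * η - r * Complex.cos θ : ℂ) ≠ 0 := by
    intro η hη θ h
    have := congrArg Complex.im h
    rw [← Complex.ofReal_cos] at this
    simp [-Complex.ofReal_cos] at this
    exact hη this
  have hne1 := hne ε hε.ne'
  have hne2 : ∀ θ : ℝ, (s - Complex.I * ε - r * Complex.cos θ : ℂ) ≠ 0 := by
    intro θ
    have := hne (-ε) (neg_ne_zero.2 hε.ne') θ
    rwa [Complex.ofReal_neg, mul_neg, ← sub_eq_add_neg] at this
  have hcong : ∀ θ : ℝ, Complex.exp (Complex.I * (n : ℤ) * θ) * conjPoisson ε (s - r * cos θ) =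
      (1 / 2 : ℂ) * (Complex.exp (Complex.I * n * θ) / (s + Complex.I * ε - r * Complex.cos θ) +
        Complex.exp (Complex.I * n * θ) / (s - Complex.I * ε - r * Complex.cos θ)) := by
    intro θ
    have e1 := hne1 θ
    have e2 := hne2 θ
    have e3 : ((s - r * Complex.cos θ) ^ 2 + ε ^ 2 : ℂ) =
        (s + Complex.I * ε - r * Complex.cos θ) * (s - Complex.I * ε - r * Complex.cos θ) := by
      linear_combination ((ε : ℂ) ^ 2) * Complex.I_sq
    unfold conjPoisson
    push_cast
    rw [e3]
    field_simp
    ring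
  unfold hilbertKernel
  have hc1 : Continuous fun θ : ℝ => Complex.exp (Complex.I * n * θ) /
      (s + Complex.I * ε - r * Complex.cos θ) := Continuous.div (by fun_prop) (by fun_prop) hne1
  have hc2 : Continuous fun θ : ℝ => Complex.exp (Complex.I * n * θ) /
      (s - Complex.I * ε - r * Complex.cos θ) := Continuous.div (by fun_prop) (by fun_prop) hne2
  rw [intervalIntegral.integral_congr (fun θ _ => hcong θ), intervalIntegral.integral_const_mul,
    intervalIntegral.integral_add (hc1.intervalIntegrable _ _) (hc2.intervalIntegrable _ _),
    h1, h2]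
  ring

lemma norm_joukowsky_kernel_le {r ε s : ℝ} (hr : 0 < r) (hs : 0 ≤ s) (hsr : s ≠ r) (n : ℕ)
    {w : ℂ} (hw0 : w ≠ 0) (hw1 : ‖w‖ < 1) (hw : (s + Complex.I * ε : ℂ) = r * (w + w⁻¹) / 2) :
    ‖2 * w ^ (n + 1) / (r * (1 - w ^ 2))‖ ≤ 1 / √(r * |s - r|) := by
  have hrC : (r : ℂ) ≠ 0 := by exact_mod_cast hr.ne'
  have hpos : 0 < r * |s - r| := mul_pos hr (abs_pos.2 (sub_ne_zero.2 hsr))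
  have h1 : (2 * w ^ (n + 1) / (r * (1 - w ^ 2)) : ℂ) = w ^ n / (r * (w⁻¹ - w) / 2) := by
    have : w⁻¹ - w = (1 - w ^ 2) / w := by field_simp
    rw [this]
    field_simp
    ring
  have h2 : ((r * (w⁻¹ - w) / 2) ^ 2 : ℂ) =
      (s + Complex.I * ε - r) * (s + Complex.I * ε + r) := by
    rw [hw]; field_simp; ring
  have h3 : r * |s - r| ≤ ‖(r * (w⁻¹ - w) / 2 : ℂ)‖ ^ 2 := by
    rw [← norm_pow, h2, norm_mul, mul_comm]
    have e1 := Complex.abs_re_le_norm (s + Complex.I * ε - r)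
    have e2 := Complex.abs_re_le_norm (s + Complex.I * ε + r)
    simp at e1 e2
    rw [abs_of_nonneg (by linarith)] at e2
    exact mul_le_mul e1 (by linarith) hr.le (norm_nonneg _)
  have h4 : √(r * |s - r|) ≤ ‖(r * (w⁻¹ - w) / 2 : ℂ)‖ := Real.sqrt_le_iff.2 ⟨norm_nonneg _, h3⟩
  rw [h1, norm_div, norm_pow]
  exact div_le_div₀ zero_le_one (pow_le_one₀ (norm_nonneg _) hw1.le) (Real.sqrt_pos.2 hpos) h4

lemma norm_hilbertKernel_le {r ε s : ℝ} (hr : 0 < r) (hε : 0 < ε) (hs : 0 ≤ s) (hsr : s ≠ r)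
    (n : ℤ) : ‖hilbertKernel n r ε s‖ ≤ 2 * π / √(r * |s - r|) := by
  obtain ⟨w, hw0, hw1, -, hw⟩ := exists_joukowsky_eq hr hε s
  have hb := norm_joukowsky_kernel_le hr hs hsr n.natAbs hw0 hw1 hw
  have hconj : (2 * (starRingEnd ℂ w) ^ (n.natAbs + 1) /
      (r * (1 - (starRingEnd ℂ w) ^ 2)) : ℂ) =
      starRingEnd ℂ (2 * w ^ (n.natAbs + 1) / (r * (1 - w ^ 2))) := by
    simp [map_ofNat]
  rw [hilbertKernel_natAbs, hilbertKernel_eq hr hε _ hw0 hw1 hw, hconj, norm_mul]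
  have hn := norm_add_le (2 * w ^ (n.natAbs + 1) / (r * (1 - w ^ 2)))
    (starRingEnd ℂ (2 * w ^ (n.natAbs + 1) / (r * (1 - w ^ 2))))
  rw [Complex.norm_conj] at hn
  rw [Complex.norm_real, Real.norm_eq_abs, abs_of_pos pi_pos]
  calc π * _ ≤ π * (2 * (1 / √(r * |s - r|))) :=
        mul_le_mul_of_nonneg_left (by linarith) pi_pos.le
    _ = _ := by ring

lemma tendsto_hilbertKernel {r s δ : ℝ} (hr : 0 < r) (hδ : 0 < δ) (n : ℕ) {a : ℂ} (ha0 : a ≠ 0)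
    (ha1 : a ^ 2 ≠ 1) (ha : (s : ℂ) = r * (a + a⁻¹) / 2)
    (hδa : ∀ w : ℂ, ‖w‖ < 1 → w.im < 0 → δ ≤ ‖w - a⁻¹‖) :
    Filter.Tendsto (fun c : ℝ => hilbertKernel n r c⁻¹ s) Filter.atTop
      (nhds (π * (2 * a ^ (n + 1) / (r * (1 - a ^ 2)) +
        2 * (starRingEnd ℂ a) ^ (n + 1) / (r * (1 - (starRingEnd ℂ a) ^ 2))))) := by
  have hrC : (r : ℂ) ≠ 0 := by exact_mod_cast hr.ne'
  have hex : ∀ c : ℝ, ∃ w : ℂ, 0 < c → (w ≠ 0 ∧ ‖w‖ < 1 ∧ w.im < 0 ∧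
      (s + Complex.I * (c⁻¹ : ℝ) : ℂ) = r * (w + w⁻¹) / 2) := by
    intro c
    by_cases hc : 0 < c
    · obtain ⟨w, hw⟩ := exists_joukowsky_eq hr (inv_pos.2 hc) s
      exact ⟨w, fun _ => hw⟩
    · exact ⟨0, fun h => absurd h hc⟩
  choose W hW using hex
  have hWlim : Filter.Tendsto W Filter.atTop (nhds a) := by
    rw [tendsto_iff_norm_sub_tendsto_zero]
    have h0 : Filter.Tendsto (fun c : ℝ => 2 / (r * δ) * c⁻¹) Filter.atTop (nhds 0) := by
      simpa using tendsto_inv_atTop_zero.const_mul (2 / (r * δ))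
    apply squeeze_zero' (Filter.Eventually.of_forall fun c => norm_nonneg _) _ h0
    filter_upwards [Filter.eventually_gt_atTop 0] with c hc
    obtain ⟨hw0, hw1, him, hw⟩ := hW c hc
    have h1 : (W c - a) * (W c - a⁻¹) = 2 / r * W c * (Complex.I * (c⁻¹ : ℝ)) := by
      have : (Complex.I * (c⁻¹ : ℝ) : ℂ) = r * (W c + (W c)⁻¹) / 2 - r * (a + a⁻¹) / 2 := by
        rw [← hw, ← ha]; ring
      rw [this]
      field_simp
      ring
    have h2 := congrArg norm h1
    rw [norm_mul, norm_mul, norm_mul, norm_mul, Complex.norm_I, Complex.norm_real,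
      Real.norm_eq_abs, abs_of_pos (inv_pos.2 hc), norm_div, Complex.norm_real,
      Real.norm_eq_abs, abs_of_pos hr, Complex.norm_ofNat, one_mul] at h2
    have h3 := hδa _ hw1 him
    have hcinv := inv_pos.2 hc
    have h4 : ‖W c - a‖ * δ ≤ 2 / r * c⁻¹ := by
      calc ‖W c - a‖ * δ ≤ ‖W c - a‖ * ‖W c - a⁻¹‖ := by gcongr
        _ = 2 / r * ‖W c‖ * c⁻¹ := h2
        _ ≤ 2 / r * 1 * c⁻¹ := by gcongr
        _ = _ := by ring
    rw [← le_div_iff₀ hδ] at h4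
    calc _ ≤ _ := h4
      _ = _ := by field_simp
  have hcont : ContinuousAt (fun w : ℂ => (π * (2 * w ^ (n + 1) / (r * (1 - w ^ 2)) +
        2 * (starRingEnd ℂ w) ^ (n + 1) / (r * (1 - (starRingEnd ℂ w) ^ 2))) : ℂ)) a := by
    have hd : (r * (1 - a ^ 2) : ℂ) ≠ 0 := mul_ne_zero hrC (sub_ne_zero.2 ha1.symm)
    have hd' : (r * (1 - (starRingEnd ℂ a) ^ 2) : ℂ) ≠ 0 := by
      have := (map_ne_zero (starRingEnd ℂ)).2 hd
      simpa using this
    have hcj := Complex.continuous_conj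
    refine continuousAt_const.mul (ContinuousAt.add ?_ ?_)
    · exact ContinuousAt.div (by fun_prop) (by fun_prop) hd
    · exact ContinuousAt.div (by fun_prop) (by fun_prop) hd'
  refine (hcont.tendsto.comp hWlim).congr' ?_
  filter_upwards [Filter.eventually_gt_atTop 0] with c hc
  obtain ⟨hw0, hw1, him, hw⟩ := hW c hc
  rw [hilbertKernel_eq hr (inv_pos.2 hc) n hw0 hw1 hw]
  rfl

lemma tendsto_hilbertKernel_of_lt {r s : ℝ} (hr : 0 < r) (hs : r < s) (n : ℤ) :
    Filter.Tendsto (fun c : ℝ => hilbertKernel n r c⁻¹ s) Filter.atTop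
      (nhds (2 * π / r * (((s / r + √(s ^ 2 / r ^ 2 - 1)) ^ (-|n|) /
        √(s ^ 2 / r ^ 2 - 1) : ℝ) : ℂ))) := by
  set q := √(s ^ 2 / r ^ 2 - 1) with hq
  have hx : 1 < s / r := (one_lt_div hr).2 hs
  have hq2 : q ^ 2 = (s / r) ^ 2 - 1 := by
    rw [hq, Real.sq_sqrt] <;> rw [← div_pow]
    nlinarith
  have hq0 : 0 < q := by
    rw [hq, ← div_pow]; apply Real.sqrt_pos.2; nlinarith
  set p := s / r + q with hp
  have hp1 : 1 < p := by linarith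
  have hp0 : 0 < p := by linarith
  have hpinv : p⁻¹ = s / r - q := by
    apply inv_eq_of_mul_eq_one_right
    rw [hp]; linear_combination -hq2
  have ha1 : 1 - (p⁻¹) ^ 2 = p⁻¹ * (2 * q) := by
    rw [show (2 * q) = p - p⁻¹ by rw [hpinv, hp]; ring]
    field_simp
  simp only [hilbertKernel_natAbs n]
  have h := tendsto_hilbertKernel hr (sub_pos.2 hp1) n.natAbs (s := s) (a := ((p⁻¹ : ℝ) : ℂ))
    (by exact_mod_cast (inv_pos.2 hp0).ne') ?_ ?_ ?_
  · convert h using 2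
    rw [Complex.conj_ofReal]
    norm_cast
    rw [ha1, Int.abs_eq_natAbs, zpow_neg, zpow_natCast, ← inv_pow]
    have hpi : 0 < p⁻¹ := inv_pos.2 hp0
    generalize p⁻¹ = a at hpi
    field_simp
    ring
  · norm_cast
    intro h
    rw [h, sub_self] at ha1
    have : 0 < p⁻¹ * (2 * q) := by positivity
    linarith
  · norm_cast
    rw [inv_inv, hpinv, hp]
    field_simp
    ring
  · intro w hw _
    rw [← Complex.ofReal_inv, inv_inv, norm_sub_rev]
    have := norm_sub_norm_le (p : ℂ) w
    rw [Complex.norm_real, Real.norm_eq_abs, abs_of_pos hp0] at this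
    linarith

lemma tendsto_hilbertKernel_of_gt {r s : ℝ} (hr : 0 < r) (hs0 : 0 ≤ s) (hs : s < r) (n : ℤ) :
    Filter.Tendsto (fun c : ℝ => hilbertKernel n r c⁻¹ s) Filter.atTop
      (nhds (-(2 * π / r) * (((Polynomial.Chebyshev.U ℝ (|n| - 1)).eval (s / r) : ℝ) : ℂ))) := by
  have hx1 : s / r < 1 := (div_lt_one hr).2 hs
  have hx0 : 0 ≤ s / r := by positivity
  obtain ⟨β, hβ⟩ : ∃ β, β = arccos (s / r) := ⟨_, rfl⟩
  have hcos : cos β = s / r := by rw [hβ]; exact cos_arccos (by linarith) hx1.le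
  have hsin : 0 < sin β := by
    rw [hβ, sin_arccos]; apply Real.sqrt_pos.2; nlinarith
  have hsC : Complex.sin β ≠ 0 := by rw [← Complex.ofReal_sin]; exact_mod_cast hsin.ne'
  have hrC : (r : ℂ) ≠ 0 := by exact_mod_cast hr.ne'
  set a := Complex.exp (-(β * Complex.I)) with ha
  have ha0 : a ≠ 0 := Complex.exp_ne_zero _
  have hainv : a⁻¹ = Complex.exp (β * Complex.I) := by rw [ha, ← Complex.exp_neg, neg_neg]
  have hconj : starRingEnd ℂ a = a⁻¹ := by
    rw [hainv, ha, ← Complex.exp_conj]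
    congr 1
    simp
  have hsub : a⁻¹ - a = 2 * Complex.I * Complex.sin β := by
    rw [hainv, ha, Complex.sin, neg_mul]
    linear_combination (-(Complex.exp (-(β * Complex.I)) - Complex.exp (β * Complex.I))) *
      Complex.I_sq
  have ha1 : 1 - a ^ 2 = a * (2 * Complex.I * Complex.sin β) := by
    rw [← hsub]; field_simp
  simp only [hilbertKernel_natAbs n]
  have h := tendsto_hilbertKernel hr hsin n.natAbs (s := s) ha0 ?_ ?_ ?_
  · convert h using 2
    rw [hconj]
    have hpow : a ^ n.natAbs - a⁻¹ ^ n.natAbs =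
        -(2 * Complex.I * Complex.sin (n.natAbs * β)) := by
      rw [hainv, ha, ← Complex.exp_nat_mul, ← Complex.exp_nat_mul, Complex.sin]
      rw [show (n.natAbs * -(β * Complex.I) : ℂ) = -(n.natAbs * β) * Complex.I by ring,
        show (n.natAbs * (β * Complex.I) : ℂ) = (n.natAbs * β) * Complex.I by ring]
      linear_combination (-Complex.exp (n.natAbs * β * Complex.I) +
        Complex.exp (-(n.natAbs * β) * Complex.I)) * Complex.I_sq
    have hU := Polynomial.Chebyshev.U_real_cos β (|n| - 1)
    rw [hcos] at hU
    have hU' : (((Polynomial.Chebyshev.U ℝ (|n| - 1)).eval (s / r) : ℝ) : ℂ) * Complex.sin β =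
        Complex.sin (n.natAbs * β) := by
      have hn : ((|n| : ℤ) : ℝ) = (n.natAbs : ℝ) := by
        rw [Int.abs_eq_natAbs, Int.cast_natCast]
      rw [← Complex.ofReal_sin, ← Complex.ofReal_mul, hU, Int.cast_sub, hn, Int.cast_one,
        sub_add_cancel]
      push_cast
      rfl
    have ha1' : 1 - a⁻¹ ^ 2 = -(a⁻¹ * (2 * Complex.I * Complex.sin β)) := by
      rw [← hsub]; field_simp; ring
    have hai0 := inv_ne_zero ha0
    rw [ha1, ha1', pow_succ, pow_succ]
    have e1 : 2 * (a ^ n.natAbs * a) / (r * (a * (2 * Complex.I * Complex.sin β))) =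
        a ^ n.natAbs / (r * (Complex.I * Complex.sin β)) := by
      field_simp
    have e2 : 2 * (a⁻¹ ^ n.natAbs * a⁻¹) / (r * -(a⁻¹ * (2 * Complex.I * Complex.sin β))) =
        -(a⁻¹ ^ n.natAbs) / (r * (Complex.I * Complex.sin β)) := by
      generalize a⁻¹ = b at hai0
      field_simp
    rw [e1, e2, ← add_div, ← sub_eq_add_neg, hpow, ← hU']
    field_simp
  · intro h
    rw [h, sub_self, eq_comm] at ha1
    simp [ha0, hsC] at ha1
  · rw [hainv, ha, add_comm, show -(β * Complex.I : ℂ) = -β * Complex.I by ring,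
      ← Complex.two_cos, ← Complex.ofReal_cos, hcos]
    push_cast
    field_simp
  · intro w _ him
    have := Complex.abs_im_le_norm (w - a⁻¹)
    rw [hainv, Complex.sub_im, Complex.exp_ofReal_mul_I_im] at this
    have h2 := neg_abs_le (w.im - sin β)
    rw [hainv]
    linarith

lemma intervalIntegrable_inv_sqrt_sub_left {r : ℝ} (hr : 0 < r) (C : ℝ) :
    IntervalIntegrable (fun s => C / √(r * |s - r|)) volume 0 r := by
  have h := (intervalIntegral.intervalIntegrable_rpow' (r := -(1 / 2)) (by norm_num)
    (a := r) (b := 0)).comp_sub_left r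
  rw [sub_self, sub_zero] at h
  refine (h.const_mul (C / √r)).congr fun s hs => ?_
  rw [uIoc_of_le hr.le] at hs
  rw [abs_sub_comm, abs_of_nonneg (by linarith [hs.2]), Real.sqrt_mul hr.le,
    Real.rpow_neg (by linarith [hs.2]), ← Real.sqrt_eq_rpow]
  ring

lemma intervalIntegrable_inv_sqrt_sub_right {r : ℝ} (hr : 0 < r) (hr1 : r < 1) (C : ℝ) :
    IntervalIntegrable (fun s => C / √(r * |s - r|)) volume r 1 := by
  have h := (intervalIntegral.intervalIntegrable_rpow' (r := -(1 / 2)) (by norm_num)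
    (a := 0) (b := 1 - r)).comp_sub_right r
  rw [zero_add, sub_add_cancel] at h
  refine (h.const_mul (C / √r)).congr fun s hs => ?_
  rw [uIoc_of_le hr1.le] at hs
  rw [abs_of_nonneg (by linarith [hs.1]), Real.sqrt_mul hr.le,
    Real.rpow_neg (by linarith [hs.1]), ← Real.sqrt_eq_rpow]
  ring

/-- The stable Cormack-Perry inversion for a function with angular frequency `n`, in terms of its
projection `G` onto the real axis. -/
theorem perry_inversion {f : ℂ → ℂ} {n : ℤ} {G G' : ℝ → ℂ} (hf : Continuous f)
    (hzero : ∀ z, 1 ≤ ‖z‖ → f z = 0)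
    (hcov : ∀ (α : ℝ) z, f (Complex.exp (α * Complex.I) * z) =
      Complex.exp (Complex.I * n * α) * f z)
    (hGdef : ∀ s : ℝ, G s = ∫ t : ℝ, f (s + t * Complex.I))
    (hG : ∀ s, HasDerivAt G (G' s) s) (hG' : Continuous G') {r : ℝ} (hr : 0 < r) (hr1 : r < 1) :
    f r = -(1 / ((π : ℂ) * (r : ℂ))) *
        ((∫ s in r..1, G' s * (((s / r + √(s ^ 2 / r ^ 2 - 1)) ^ (-|n|) /
            √(s ^ 2 / r ^ 2 - 1) : ℝ) : ℂ)) -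
          ∫ s in (0 : ℝ)..r,
            G' s * (((Polynomial.Chebyshev.U ℝ (|n| - 1)).eval (s / r) : ℝ) : ℂ)) := by
  set σ := Complex.exp (Complex.I * n * π) with hσ
  have hσ2 : σ * σ = 1 := exp_I_mul_int_mul_pi_mul_self n
  have hGneg : ∀ s, G (-s) = σ * G s := by
    intro s
    rw [hGdef, hGdef, ← integral_neg_eq_self, ← integral_const_mul]
    congr 1
    ext t
    rw [hσ, ← hcov π, Complex.exp_pi_mul_I]
    congr 1
    push_cast
    ring
  have hG'neg : ∀ s, G' (-s) = -σ * G' s := by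
    intro s
    have h1 := (hG (-s)).scomp s (hasDerivAt_neg s)
    have h2 := (hG s).const_mul σ
    have h3 : (G ∘ Neg.neg) = fun s => σ * G s := funext hGneg
    have h4 := h1.unique (h3 ▸ h2)
    simp only [neg_smul, one_smul] at h4
    linear_combination -h4
  obtain ⟨M, hM⟩ : ∃ M : ℝ, ∀ s ∈ Icc (0 : ℝ) 1, ‖G' s‖ ≤ M :=
    isCompact_Icc.exists_bound_of_continuousOn hG'.continuousOn
  have hlim0 := tendsto_integral_planarPoisson hf (integrable_of_eq_zero_outside hf hzero) (r : ℂ)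
  have hbound : ∀ c : ℝ, 0 < c → ∀ s ∈ Icc (0 : ℝ) 1, s ≠ r →
      ‖G' s * hilbertKernel n r c⁻¹ s‖ ≤ M * (2 * π) / √(r * |s - r|) := by
    intro c hc s hs hsr
    rw [norm_mul, mul_div_assoc]
    have h0 := hM s hs
    exact mul_le_mul h0 (norm_hilbertKernel_le hr (inv_pos.2 hc) hs.1 hsr n) (norm_nonneg _)
      ((norm_nonneg _).trans h0)
  have hcontc : ∀ c : ℝ, 0 < c → Continuous fun s => G' s * hilbertKernel n r c⁻¹ s :=
    fun c hc => hG'.mul (continuous_hilbertKernel n r (inv_pos.2 hc))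
  have hsplit : ∀ c : ℝ, 0 < c →
      ∫ w, (c ^ 2 * planarPoisson (c • ((r : ℂ) - w))) • f w = -(2 * π ^ 2 : ℂ)⁻¹ *
        ((∫ s in (0 : ℝ)..r, G' s * hilbertKernel n r c⁻¹ s) +
          ∫ s in r..1, G' s * hilbertKernel n r c⁻¹ s) := by
    intro c hc
    have hcont := hcontc c hc
    rw [integral_poisson_eq_integral_hilbertKernel hf hzero hcov hGdef hG hG' hc r,
      intervalIntegral.integral_add_adjacent_intervals (hcont.intervalIntegrable _ _)
        (hcont.intervalIntegrable _ _),
      ← intervalIntegral.integral_add_adjacent_intervals (hcont.intervalIntegrable (-1) 0)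
        (hcont.intervalIntegrable 0 1)]
    have hev : ∫ s in (-1 : ℝ)..0, G' s * hilbertKernel n r c⁻¹ s =
        ∫ s in (0 : ℝ)..1, G' s * hilbertKernel n r c⁻¹ s := by
      have := intervalIntegral.integral_comp_neg (a := 0) (b := 1)
        (fun s => G' s * hilbertKernel n r c⁻¹ s)
      rw [neg_zero] at this
      rw [← this]
      apply intervalIntegral.integral_congr
      intro s _
      simp only
      rw [hG'neg, hilbertKernel_neg_right]
      linear_combination (G' s * hilbertKernel n r c⁻¹ s) * hσ2
    rw [hev]
    have hpi : (π : ℂ) ≠ 0 := by exact_mod_cast pi_ne_zero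
    field_simp
    ring
  have hne : ∀ᵐ s : ℝ, s ≠ r := by simp [ae_iff]
  have hlimL : Filter.Tendsto (fun c : ℝ => ∫ s in (0 : ℝ)..r, G' s * hilbertKernel n r c⁻¹ s)
      Filter.atTop (nhds (∫ s in (0 : ℝ)..r, G' s * (-(2 * π / r) *
        (((Polynomial.Chebyshev.U ℝ (|n| - 1)).eval (s / r) : ℝ) : ℂ)))) := by
    apply intervalIntegral.tendsto_integral_filter_of_dominated_convergence
      (fun s => M * (2 * π) / √(r * |s - r|))
    · filter_upwards [Filter.eventually_gt_atTop 0] with c hc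
      exact (hcontc c hc).aestronglyMeasurable
    · filter_upwards [Filter.eventually_gt_atTop 0] with c hc
      filter_upwards [hne] with s hs hmem
      rw [uIoc_of_le hr.le] at hmem
      exact hbound c hc s ⟨hmem.1.le, hmem.2.trans hr1.le⟩ hs
    · exact intervalIntegrable_inv_sqrt_sub_left hr _
    · filter_upwards [hne] with s hs hmem
      rw [uIoc_of_le hr.le] at hmem
      exact (tendsto_hilbertKernel_of_gt hr hmem.1.le (lt_of_le_of_ne hmem.2 hs) n).const_mul _
  have hlimR : Filter.Tendsto (fun c : ℝ => ∫ s in r..1, G' s * hilbertKernel n r c⁻¹ s)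
      Filter.atTop (nhds (∫ s in r..1, G' s * (2 * π / r *
        (((s / r + √(s ^ 2 / r ^ 2 - 1)) ^ (-|n|) / √(s ^ 2 / r ^ 2 - 1) : ℝ) : ℂ)))) := by
    apply intervalIntegral.tendsto_integral_filter_of_dominated_convergence
      (fun s => M * (2 * π) / √(r * |s - r|))
    · filter_upwards [Filter.eventually_gt_atTop 0] with c hc
      exact (hcontc c hc).aestronglyMeasurable
    · filter_upwards [Filter.eventually_gt_atTop 0] with c hc
      filter_upwards [hne] with s hs hmem
      rw [uIoc_of_le hr1.le] at hmem
      exact hbound c hc s ⟨(hr.trans hmem.1).le, hmem.2⟩ hs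
    · exact intervalIntegrable_inv_sqrt_sub_right hr hr1 _
    · filter_upwards with s hmem
      rw [uIoc_of_le hr1.le] at hmem
      exact (tendsto_hilbertKernel_of_lt hr hmem.1 n).const_mul _
  have hlim := (hlimL.add hlimR).const_mul (-(2 * π ^ 2 : ℂ)⁻¹)
  have heq := tendsto_nhds_unique (hlim0.congr' (by
    filter_upwards [Filter.eventually_gt_atTop 0] with c hc using hsplit c hc)) hlim
  rw [heq]
  simp only [mul_left_comm (G' _), intervalIntegral.integral_const_mul]
  have hpi : (π : ℂ) ≠ 0 := by exact_mod_cast pi_ne_zero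
  have hrC : (r : ℂ) ≠ 0 := by exact_mod_cast hr.ne'
  field_simp
  ring

lemma hasDerivAt_intervalIntegral_of_continuous {F F' : ℝ → ℝ → ℂ}
    (hF : Continuous (Function.uncurry F)) (hF' : Continuous (Function.uncurry F'))
    (hd : ∀ s t, HasDerivAt (fun s => F s t) (F' s t) s) (a b s : ℝ) :
    HasDerivAt (fun s => ∫ t in a..b, F s t) (∫ t in a..b, F' s t) s := by
  obtain ⟨M, hM⟩ : ∃ M : ℝ, ∀ p ∈ Metric.closedBall s 1 ×ˢ uIcc a b,
      ‖Function.uncurry F' p‖ ≤ M :=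
    ((isCompact_closedBall s 1).prod isCompact_uIcc).exists_bound_of_continuousOn
      hF'.continuousOn
  refine (intervalIntegral.hasDerivAt_integral_of_dominated_loc_of_deriv_le
    (bound := fun _ => M) (Metric.ball_mem_nhds s one_pos) (Filter.Eventually.of_forall fun s =>
      (hF.comp (Continuous.prodMk_right s)).aestronglyMeasurable)
    ((hF.comp (Continuous.prodMk_right s)).intervalIntegrable a b)
    (hF'.comp (Continuous.prodMk_right s)).aestronglyMeasurable
    (ae_of_all _ fun t ht x hx => hM (x, t) ⟨Metric.ball_subset_closedBall hx,
      uIoc_subset_uIcc ht⟩) (by simp) (ae_of_all _ fun t _ x _ => hd x t)).2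

/-- A real function on the plane, as a complex-valued function on `ℂ`. -/
def complexify (h : ℝ × ℝ → ℝ) (z : ℂ) : ℂ := h (z.re, z.im)

/-- The component of angular frequency `n` of a function on `ℂ`. -/
def angularPart (H : ℂ → ℂ) (n : ℤ) (z : ℂ) : ℂ :=
  (1 / (2 * (π : ℂ))) * ∫ φ in (0 : ℝ)..(2 * π),
    H (Complex.exp (φ * Complex.I) * z) * Complex.exp (-Complex.I * n * φ)

lemma continuous_angularPart {H : ℂ → ℂ} (hH : Continuous H) (n : ℤ) :
    Continuous (angularPart H n) := by
  unfold angularPart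
  refine continuous_const.mul
    (intervalIntegral.continuous_parametric_intervalIntegral_of_continuous' ?_ _ _)
  unfold Function.uncurry
  fun_prop

lemma norm_exp_mul_I_mul (φ : ℝ) (z : ℂ) : ‖Complex.exp (φ * Complex.I) * z‖ = ‖z‖ := by
  rw [norm_mul, Complex.norm_exp_ofReal_mul_I, one_mul]

lemma angularPart_eq_zero {H : ℂ → ℂ} (hzero : ∀ z, 1 ≤ ‖z‖ → H z = 0) (n : ℤ) (z : ℂ)
    (hz : 1 ≤ ‖z‖) : angularPart H n z = 0 := by
  have h : ∀ φ : ℝ, H (Complex.exp (φ * Complex.I) * z) = 0 := fun φ =>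
    hzero _ (by rwa [norm_exp_mul_I_mul])
  simp [angularPart, h]

lemma angularPart_exp_mul (H : ℂ → ℂ) (n : ℤ) (α : ℝ) (z : ℂ) :
    angularPart H n (Complex.exp (α * Complex.I) * z) =
      Complex.exp (Complex.I * n * α) * angularPart H n z := by
  set P : ℝ → ℂ := fun φ =>
    H (Complex.exp (φ * Complex.I) * z) * Complex.exp (-Complex.I * n * φ) with hP
  have hper : Function.Periodic P (2 * π) := by
    intro φ
    have h1 := exp_I_mul_int_mul_add_two_pi 1 φ
    have h2 := exp_I_mul_int_mul_add_two_pi (-n) φ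
    rw [Int.cast_one, mul_one, mul_comm, mul_comm Complex.I] at h1
    simp only [hP]
    rw [h1]
    congr 1
    convert h2 using 2 <;> push_cast <;> ring
  have hshift : ∀ φ : ℝ, H (Complex.exp (φ * Complex.I) * (Complex.exp (α * Complex.I) * z)) *
      Complex.exp (-Complex.I * n * φ) = Complex.exp (Complex.I * n * α) * P (φ + α) := by
    intro φ
    simp only [hP]
    rw [← mul_assoc, ← Complex.exp_add, mul_left_comm, ← Complex.exp_add]
    congr 2
    · congr 2
      push_cast
      ring
    · push_cast
      ring
  unfold angularPart
  simp only [hshift]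
  rw [intervalIntegral.integral_const_mul, intervalIntegral.integral_comp_add_right,
    zero_add, add_comm (2 * π), hper.intervalIntegral_add_eq α 0, zero_add]
  ring

lemma integral_eq_intervalIntegral_of_eq_zero {F : ℝ → ℂ} {R : ℝ}
    (hF : ∀ t, R ≤ |t| → F t = 0) : ∫ t, F t = ∫ t in (-R)..R, F t := by
  refine (intervalIntegral.integral_eq_integral_of_support_subset fun t ht => ?_).symm
  by_contra hmem
  refine ht (hF t ?_)
  by_contra! hlt
  exact hmem ⟨(abs_lt.1 hlt).1, (abs_lt.1 hlt).2.le⟩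

lemma abs_im_le_norm_add_mul_I (s t : ℝ) : |t| ≤ ‖(s + t * Complex.I : ℂ)‖ := by
  simpa using Complex.abs_im_le_norm (s + t * Complex.I : ℂ)

/-- The projection of a smooth angular component onto the real axis is continuously
differentiable. -/
lemma exists_hasDerivAt_integral_angularPart {H : ℂ → ℂ} (hH : ContDiff ℝ 1 H)
    (hzero : ∀ z, 1 ≤ ‖z‖ → H z = 0) (n : ℤ) :
    ∃ G' : ℝ → ℂ, Continuous G' ∧ ∀ s, HasDerivAt
      (fun s : ℝ => ∫ t : ℝ, angularPart H n (s + t * Complex.I)) (G' s) s := by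
  have hH0 := hH.continuous
  have hH1 : Continuous (fderiv ℝ H) := hH.continuous_fderiv (by simp)
  set F' : ℝ → ℝ → ℂ := fun s t => (1 / (2 * (π : ℂ))) * ∫ φ in (0 : ℝ)..(2 * π),
    fderiv ℝ H (Complex.exp (φ * Complex.I) * (s + t * Complex.I))
      (Complex.exp (φ * Complex.I)) * Complex.exp (-Complex.I * n * φ) with hF'
  have hF'c : Continuous (Function.uncurry F') := by
    refine continuous_const.mul
      (intervalIntegral.continuous_parametric_intervalIntegral_of_continuous' ?_ _ _)
    unfold Function.uncurry
    fun_prop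
  have hd : ∀ s t : ℝ, HasDerivAt (fun s : ℝ => angularPart H n (s + t * Complex.I))
      (F' s t) s := by
    intro s t
    refine HasDerivAt.const_mul _ (hasDerivAt_intervalIntegral_of_continuous (F := fun s φ =>
      H (Complex.exp (φ * Complex.I) * (s + t * Complex.I)) * Complex.exp (-Complex.I * n * φ))
      (F' := fun s φ => fderiv ℝ H (Complex.exp (φ * Complex.I) * (s + t * Complex.I))
      (Complex.exp (φ * Complex.I)) * Complex.exp (-Complex.I * n * φ)) ?_ ?_ ?_ 0 (2 * π) s)
    · unfold Function.uncurry
      fun_prop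
    · unfold Function.uncurry
      fun_prop
    · intro s φ
      refine HasDerivAt.mul_const ?_ _
      have h1 : HasDerivAt (fun s : ℝ => Complex.exp (φ * Complex.I) * (s + t * Complex.I))
          (Complex.exp (φ * Complex.I)) s := by
        simpa using ((Complex.ofRealCLM.hasDerivAt (x := s)).add_const
          (t * Complex.I)).const_mul (Complex.exp (φ * Complex.I))
      exact ((hH.differentiable (by simp)) _).hasFDerivAt.comp_hasDerivAt s h1
  refine ⟨fun s => ∫ t in (-1 : ℝ)..1, F' s t,
    intervalIntegral.continuous_parametric_intervalIntegral_of_continuous' hF'c _ _,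
    fun s => ?_⟩
  have hG : (fun s : ℝ => ∫ t : ℝ, angularPart H n (s + t * Complex.I)) =
      fun s : ℝ => ∫ t in (-1 : ℝ)..1, angularPart H n (s + t * Complex.I) := by
    ext s
    exact integral_eq_intervalIntegral_of_eq_zero fun t ht =>
      angularPart_eq_zero hzero n _ (ht.trans (abs_im_le_norm_add_mul_I s t))
  rw [hG]
  refine hasDerivAt_intervalIntegral_of_continuous ?_ hF'c hd _ _ s
  have := continuous_angularPart hH0 n
  unfold Function.uncurry
  fun_prop

lemma complexify_eq_zero {h : ℝ × ℝ → ℝ} (hsupp : Function.support h ⊆ unitDisk) (z : ℂ)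
    (hz : 1 ≤ ‖z‖) : complexify h z = 0 := by
  unfold complexify
  rw [Complex.ofReal_eq_zero]
  by_contra hne
  have h1 : z.re ^ 2 + z.im ^ 2 < 1 := hsupp hne
  have h2 := Complex.sq_norm z
  rw [Complex.normSq_apply] at h2
  nlinarith

lemma contDiff_complexify {h : ℝ × ℝ → ℝ} {k : WithTop ℕ∞} (hh : ContDiff ℝ k h) :
    ContDiff ℝ k (complexify h) :=
  Complex.ofRealCLM.contDiff.comp
    (hh.comp (Complex.reCLM.contDiff.prodMk Complex.imCLM.contDiff))

lemma apply_Phi_add_smul_Phi (h : ℝ × ℝ → ℝ) (φ β t : ℝ) :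
    (h (Phi φ + t • Phi (φ + β)) : ℂ) =
      complexify h (Complex.exp (φ * Complex.I) * (1 + t * Complex.exp (β * Complex.I))) := by
  have e : Complex.exp (φ * Complex.I) * (1 + t * Complex.exp (β * Complex.I)) =
      Complex.exp (φ * Complex.I) + t * Complex.exp ((φ + β : ℝ) * Complex.I) := by
    rw [Complex.ofReal_add, add_mul, Complex.exp_add]
    ring
  rw [e, complexify]
  simp only [Phi, Complex.add_re, Complex.add_im, Complex.re_ofReal_mul, Complex.im_ofReal_mul,
    Complex.exp_ofReal_mul_I_re, Complex.exp_ofReal_mul_I_im, Prod.smul_mk, Prod.mk_add_mk,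
    smul_eq_mul]

lemma fourierCoeff'_smul_Phi (h : ℝ × ℝ → ℝ) (n : ℤ) (r : ℝ) :
    fourierCoeff' (fun φ => h (r • Phi φ)) n = angularPart (complexify h) n r := by
  unfold fourierCoeff' angularPart complexify
  congr 2
  ext φ
  simp only [Phi, Complex.re_mul_ofReal, Complex.im_mul_ofReal, Complex.exp_ofReal_mul_I_re,
    Complex.exp_ofReal_mul_I_im, Prod.smul_mk, smul_eq_mul, mul_comm r]

lemma one_le_norm_of_two_le_abs {t : ℝ} (ht : 2 ≤ |t|) (β : ℝ) :
    1 ≤ ‖(1 + t * Complex.exp (β * Complex.I) : ℂ)‖ := by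
  have := norm_sub_norm_le (t * Complex.exp (β * Complex.I)) (-1)
  rw [norm_mul, Complex.norm_exp_ofReal_mul_I, Complex.norm_real, norm_neg, norm_one,
    sub_neg_eq_add, add_comm _ (1 : ℂ), Real.norm_eq_abs] at this
  linarith

lemma one_le_norm_of_nonpos {t β : ℝ} (ht : t ≤ 0) (hβ : cos β ≤ 0) :
    1 ≤ ‖(1 + t * Complex.exp (β * Complex.I) : ℂ)‖ := by
  refine le_trans ?_ (Complex.re_le_norm _)
  simp only [Complex.add_re, Complex.one_re, Complex.re_ofReal_mul,
    Complex.exp_ofReal_mul_I_re]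
  nlinarith [mul_nonneg_of_nonpos_of_nonpos ht hβ]

lemma setIntegral_ray {h : ℝ × ℝ → ℝ} (hsupp : Function.support h ⊆ unitDisk) {β : ℝ}
    (hβ : cos β ≤ 0) (φ : ℝ) :
    ((∫ t in Ioi (0 : ℝ), h (Phi φ + t • Phi (φ + β)) : ℝ) : ℂ) =
      ∫ t : ℝ, complexify h
        (Complex.exp (φ * Complex.I) * (1 + t * Complex.exp (β * Complex.I))) := by
  rw [← integral_complex_ofReal]
  simp only [apply_Phi_add_smul_Phi]
  refine setIntegral_eq_integral_of_forall_compl_eq_zero fun t ht => ?_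
  refine complexify_eq_zero hsupp _ ?_
  rw [norm_exp_mul_I_mul]
  exact one_le_norm_of_nonpos (not_lt.1 ht) hβ

lemma continuous_setIntegral_ray {h : ℝ × ℝ → ℝ} (hh : Continuous h)
    (hsupp : Function.support h ⊆ unitDisk) {β : ℝ} (hβ : cos β ≤ 0) :
    Continuous fun φ : ℝ =>
      ((∫ t in Ioi (0 : ℝ), h (Phi φ + t • Phi (φ + β)) : ℝ) : ℂ) := by
  have hH : Continuous (complexify h) :=
    (contDiff_complexify (k := 0) (contDiff_zero.2 hh)).continuous
  have e : (fun φ : ℝ => ((∫ t in Ioi (0 : ℝ), h (Phi φ + t • Phi (φ + β)) : ℝ) : ℂ)) =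
      fun φ : ℝ => ∫ t in (-2 : ℝ)..2, complexify h
        (Complex.exp (φ * Complex.I) * (1 + t * Complex.exp (β * Complex.I))) := by
    ext φ
    rw [setIntegral_ray hsupp hβ]
    refine integral_eq_intervalIntegral_of_eq_zero fun t ht => complexify_eq_zero hsupp _ ?_
    rw [norm_exp_mul_I_mul]
    exact one_le_norm_of_two_le_abs ht β
  rw [e]
  refine intervalIntegral.continuous_parametric_intervalIntegral_of_continuous' ?_ _ _
  unfold Function.uncurry
  fun_prop

/-- The angular Fourier coefficients of a divergent beam transform. -/
lemma fourierCoeff'_ray {h : ℝ × ℝ → ℝ} (hh : Continuous h)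
    (hsupp : Function.support h ⊆ unitDisk) {β : ℝ} (hβ : cos β ≤ 0) (n : ℤ) :
    fourierCoeff' (fun φ => ∫ t in Ioi (0 : ℝ), h (Phi φ + t • Phi (φ + β))) n =
      Complex.exp (Complex.I * n * (β - π / 2 : ℝ)) *
        ∫ t : ℝ, angularPart (complexify h) n (sin β + t * Complex.I) := by
  have hH : Continuous (complexify h) :=
    (contDiff_complexify (k := 0) (contDiff_zero.2 hh)).continuous
  have hswap := intervalIntegral_integral_swap_of_forall_eq_zero (F := fun φ t : ℝ =>
    complexify h (Complex.exp (φ * Complex.I) * (1 + t * Complex.exp (β * Complex.I))) *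
      Complex.exp (-Complex.I * n * φ)) (R := 2) (by unfold Function.uncurry; fun_prop)
    (fun φ t ht => by
      rw [complexify_eq_zero hsupp _ (by
        rw [norm_exp_mul_I_mul]; exact one_le_norm_of_two_le_abs ht β), zero_mul]) 0 (2 * π)
  have hrot : ∀ t : ℝ, angularPart (complexify h) n (1 + t * Complex.exp (β * Complex.I)) =
      Complex.exp (Complex.I * n * (β - π / 2 : ℝ)) *
        angularPart (complexify h) n (sin β + (t + cos β : ℝ) * Complex.I) := by
    intro t
    rw [← angularPart_exp_mul]
    congr 1
    have e1 : Complex.exp ((β - π / 2 : ℝ) * Complex.I) =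
        -Complex.I * Complex.exp (β * Complex.I) := by
      rw [Complex.ofReal_sub, sub_mul, Complex.exp_sub]
      push_cast
      rw [Complex.exp_pi_div_two_mul_I, Complex.div_I]
      ring
    rw [e1, Complex.exp_mul_I]
    push_cast
    have := Complex.sin_sq_add_cos_sq (β : ℂ)
    linear_combination -this + (Complex.cos β * (t + Complex.cos β) + Complex.sin β ^ 2 +
      Complex.I * Complex.sin β * (t + Complex.cos β)) * Complex.I_sq
  unfold fourierCoeff'
  simp only [setIntegral_ray hsupp hβ, ← integral_mul_const]
  rw [hswap, ← integral_const_mul]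
  change ∫ t : ℝ, angularPart (complexify h) n (1 + t * Complex.exp (β * Complex.I)) = _
  simp only [hrot]
  rw [integral_const_mul, integral_add_right_eq_self
    (fun t : ℝ => angularPart (complexify h) n (sin β + t * Complex.I)) (cos β)]

lemma fourierCoeff'_add_const_mul {A B : ℝ → ℝ} (hA : Continuous fun φ => (A φ : ℂ))
    (hB : Continuous fun φ => (B φ : ℂ)) (c₁ c₂ : ℝ) (n : ℤ) :
    fourierCoeff' (fun φ => c₁ * A φ + c₂ * B φ) n =
      c₁ * fourierCoeff' A n + c₂ * fourierCoeff' B n := by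
  have hE : Continuous fun φ : ℝ => Complex.exp (-Complex.I * n * φ) := by fun_prop
  have hsplit : ∫ φ in (0 : ℝ)..(2 * π),
      ((c₁ * A φ + c₂ * B φ : ℝ) : ℂ) * Complex.exp (-Complex.I * n * φ) =
      c₁ * (∫ φ in (0 : ℝ)..(2 * π), (A φ : ℂ) * Complex.exp (-Complex.I * n * φ)) +
        c₂ * ∫ φ in (0 : ℝ)..(2 * π), (B φ : ℂ) * Complex.exp (-Complex.I * n * φ) := by
    rw [← intervalIntegral.integral_const_mul, ← intervalIntegral.integral_const_mul,
      ← intervalIntegral.integral_add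
        (Continuous.intervalIntegrable (by fun_prop) _ _)
        (Continuous.intervalIntegrable (by fun_prop) _ _)]
    congr 1
    ext φ
    push_cast
    ring
  unfold fourierCoeff'
  rw [hsplit]
  ring

/-- The angular Fourier coefficients of the weighted V-line transform are, up to an explicit
factor, projections of the corresponding angular component. -/
lemma fourierCoeff'_Vw {h : ℝ × ℝ → ℝ} (hh : Continuous h)
    (hsupp : Function.support h ⊆ unitDisk) (c₁ c₂ : ℝ) (n : ℤ) {ψ : ℝ} (hψ : 0 ≤ cos ψ) :
    fourierCoeff' (fun φ => Vw c₁ c₂ h φ ψ) n =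
      (c₁ * Complex.exp (-Complex.I * n * (ψ - π / 2 : ℝ)) +
        c₂ * Complex.exp (Complex.I * n * (ψ - π / 2 : ℝ))) *
        ∫ t : ℝ, angularPart (complexify h) n (sin ψ + t * Complex.I) := by
  have hβ₁ : cos (π - ψ) ≤ 0 := by rw [cos_pi_sub]; linarith
  have hβ₂ : cos (π + ψ) ≤ 0 := by rw [add_comm, cos_add_pi]; linarith
  have hV : (fun φ => Vw c₁ c₂ h φ ψ) = fun φ =>
      c₁ * (∫ t in Ioi (0 : ℝ), h (Phi φ + t • Phi (φ + (π - ψ)))) +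
        c₂ * ∫ t in Ioi (0 : ℝ), h (Phi φ + t • Phi (φ + (π + ψ))) := by
    ext φ
    rw [Vw, show π + φ - ψ = φ + (π - ψ) by ring, show π + φ + ψ = φ + (π + ψ) by ring]
  have hneg : ∫ t : ℝ, angularPart (complexify h) n (-sin ψ + t * Complex.I) =
      Complex.exp (Complex.I * n * π) *
        ∫ t : ℝ, angularPart (complexify h) n (sin ψ + t * Complex.I) := by
    rw [← integral_neg_eq_self, ← integral_const_mul]
    congr 1
    ext t
    rw [← angularPart_exp_mul, Complex.exp_pi_mul_I]
    congr 1
    push_cast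
    ring
  rw [hV, fourierCoeff'_add_const_mul (continuous_setIntegral_ray hh hsupp hβ₁)
    (continuous_setIntegral_ray hh hsupp hβ₂), fourierCoeff'_ray hh hsupp hβ₁,
    fourierCoeff'_ray hh hsupp hβ₂, sin_pi_sub, show sin (π + ψ) = -sin ψ by
      rw [add_comm, sin_add_pi], Complex.ofReal_neg, hneg]
  have e1 : Complex.exp (Complex.I * n * (π - ψ - π / 2 : ℝ)) =
      Complex.exp (-Complex.I * n * (ψ - π / 2 : ℝ)) := by
    congr 1
    push_cast
    ring
  have e2 : Complex.exp (Complex.I * n * (π + ψ - π / 2 : ℝ)) *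
      Complex.exp (Complex.I * n * π) = Complex.exp (Complex.I * n * (ψ - π / 2 : ℝ)) := by
    rw [← Complex.exp_add, ← exp_I_mul_int_mul_add_two_pi n (ψ - π / 2)]
    congr 1
    push_cast
    ring
  rw [e1, ← mul_assoc (Complex.exp _) (Complex.exp _), e2]
  ring

/-- Perry-type inversion of the weighted V-line transform. -/
theorem weighted_Vline_perry_inversion (h : ℝ × ℝ → ℝ) (hsm : ContDiff ℝ (⊤ : ℕ∞) h)
    (hsupp : Function.support h ⊆ unitDisk) (c₁ c₂ : ℝ) (hc₁ : c₁ ≠ 0) (hc₂ : c₂ ≠ 0)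
    (n : ℤ)
    (hden : ∀ s ∈ Ioo (0 : ℝ) 1,
      (c₁ : ℂ) * Complex.exp (-Complex.I * n * ((Real.arcsin s - π / 2 : ℝ) : ℂ)) +
        (c₂ : ℂ) * Complex.exp (Complex.I * n * ((Real.arcsin s - π / 2 : ℝ) : ℂ)) ≠ 0)
    (g : ℝ → ℂ)
    (hg : ∀ s ∈ Ioo (0 : ℝ) 1,
      g s = fourierCoeff' (fun φ => Vw c₁ c₂ h φ (Real.arcsin s)) n /
        ((c₁ : ℂ) * Complex.exp (-Complex.I * n * ((Real.arcsin s - π / 2 : ℝ) : ℂ)) +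
          (c₂ : ℂ) * Complex.exp (Complex.I * n * ((Real.arcsin s - π / 2 : ℝ) : ℂ))))
    (r : ℝ) (hr0 : 0 < r) (hr1 : r < 1) :
    fourierCoeff' (fun φ => h (r • Phi φ)) n =
      -(1 / ((π : ℂ) * (r : ℂ))) *
        ((∫ s in r..1,
            deriv g s *
              (((s / r + Real.sqrt (s ^ 2 / r ^ 2 - 1)) ^ (-|n|) /
                  Real.sqrt (s ^ 2 / r ^ 2 - 1) : ℝ) : ℂ)) -
          ∫ s in (0 : ℝ)..r,
            deriv g s *
              (((Polynomial.Chebyshev.U ℝ (|n| - 1)).eval (s / r) : ℝ) : ℂ)) := by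
  have hh : Continuous h := hsm.continuous
  have hzero := complexify_eq_zero hsupp
  have hH : ContDiff ℝ 1 (complexify h) :=
    contDiff_complexify (hsm.of_le (by exact_mod_cast le_top))
  obtain ⟨G', hG'c, hG'⟩ := exists_hasDerivAt_integral_angularPart hH hzero n
  have hgG : ∀ s ∈ Ioo (0 : ℝ) 1,
      g s = ∫ t : ℝ, angularPart (complexify h) n (s + t * Complex.I) := by
    intro s hs
    rw [hg s hs, fourierCoeff'_Vw hh hsupp c₁ c₂ n (cos_arcsin_nonneg s),
      mul_div_cancel_left₀ _ (hden s hs), sin_arcsin (by linarith [hs.1]) hs.2.le]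
  have hderiv : ∀ s ∈ Ioo (0 : ℝ) 1, deriv g s = G' s := by
    intro s hs
    refine ((hG' s).congr_of_eventuallyEq ?_).deriv
    filter_upwards [isOpen_Ioo.mem_nhds hs] with x hx using hgG x hx
  have hne : ∀ᵐ s : ℝ, s ≠ 1 := by simp [ae_iff]
  have hR : ∀ K : ℝ → ℂ, ∫ s in r..1, deriv g s * K s = ∫ s in r..1, G' s * K s := by
    intro K
    refine intervalIntegral.integral_congr_ae ?_
    filter_upwards [hne] with s hs hmem
    rw [uIoc_of_le hr1.le] at hmem
    rw [hderiv s ⟨hr0.trans hmem.1, lt_of_le_of_ne hmem.2 hs⟩]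
  have hL : ∀ K : ℝ → ℂ, ∫ s in (0 : ℝ)..r, deriv g s * K s = ∫ s in (0 : ℝ)..r, G' s * K s := by
    intro K
    refine intervalIntegral.integral_congr_ae (ae_of_all _ fun s hmem => ?_)
    rw [uIoc_of_le hr0.le] at hmem
    rw [hderiv s ⟨hmem.1, hmem.2.trans_lt hr1⟩]
  rw [fourierCoeff'_smul_Phi, hR, hL]
  exact perry_inversion (continuous_angularPart hH.continuous n)
    (angularPart_eq_zero hzero n) (angularPart_exp_mul _ n) (fun _ => rfl) hG' hG'c hr0 hr1
end
end

section
/- Let h : ℝ² → ℝ be a smooth compactly supported function and let k ∈ {1, 2}. Then for all s ∈ ℝ and θ ∈ ℝ, the Radon transform of the partial derivative ∂h/∂x_k satisfies R(∂h/∂x_k)(s, θ) = (Φ(θ))_k · (∂/∂s) Rh(s, θ), where (Φ(θ))₁ = cos θ and (Φ(θ))₂ = sin θ. -/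
open Real MeasureTheory Set

noncomputable section

/-- The coordinates of a vector in the plane, indexed by `Fin 2`. -/
def coord (w : ℝ × ℝ) : Fin 2 → ℝ := ![w.1, w.2]

/-- The standard basis vectors of the plane. -/
def stdBasis : Fin 2 → ℝ × ℝ := ![(1, 0), (0, 1)]

/-- The point with coordinates `(s, t)` in the frame `(Φ θ, Φ (θ + π / 2))`. -/
theorem frame_apply (s t θ : ℝ) :
    s • Phi θ + t • Phi (θ + π / 2) =
      (s * Real.cos θ - t * Real.sin θ, s * Real.sin θ + t * Real.cos θ) := by
  simp [Phi, Real.cos_add_pi_div_two, Real.sin_add_pi_div_two, sub_eq_add_neg]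

/-- The standard basis expressed in the orthonormal frame `(Φ θ, Φ (θ + π / 2))`. -/
theorem stdBasis_eq_frame (k : Fin 2) (θ : ℝ) :
    stdBasis k = coord (Phi θ) k • Phi θ + coord (Phi (θ + π / 2)) k • Phi (θ + π / 2) := by
  have hcs := Real.sin_sq_add_cos_sq θ
  rw [frame_apply]
  fin_cases k <;>
    simp only [stdBasis, coord, Phi, Real.cos_add_pi_div_two, Real.sin_add_pi_div_two] <;>
    ext <;> simp <;> linarith

/-- A compactly supported function vanishes far out along all lines of direction
`Φ (θ + π / 2)`, uniformly in the offset. -/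
theorem HasCompactSupport.exists_eq_zero_of_frame {E : Type*} [Zero E] {g : ℝ × ℝ → E}
    (hg : HasCompactSupport g) (θ : ℝ) :
    ∃ R : ℝ, ∀ s t : ℝ, R < |t| → g (s • Phi θ + t • Phi (θ + π / 2)) = 0 := by
  obtain ⟨C, hC⟩ := hg.isCompact.isBounded.exists_norm_le
  refine ⟨2 * C, fun s t ht => ?_⟩
  by_contra hne
  have hmem := hC _ (subset_tsupport _ hne)
  rw [frame_apply, Prod.norm_def, max_le_iff, Real.norm_eq_abs, Real.norm_eq_abs] at hmem
  set u := s * Real.cos θ - t * Real.sin θ with hu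
  set v := s * Real.sin θ + t * Real.cos θ with hv
  have htuv : t = v * Real.cos θ - u * Real.sin θ := by
    rw [hu, hv]
    linear_combination (-t) * Real.sin_sq_add_cos_sq θ
  have hbound : |t| ≤ |v| + |u| := by
    calc |t| = |v * Real.cos θ - u * Real.sin θ| := by rw [← htuv]
      _ ≤ |v * Real.cos θ| + |u * Real.sin θ| := abs_sub _ _
      _ ≤ |v| + |u| := by
        rw [abs_mul, abs_mul]
        exact add_le_add (mul_le_of_le_one_right (abs_nonneg _) (Real.abs_cos_le_one θ))
          (mul_le_of_le_one_right (abs_nonneg _) (Real.abs_sin_le_one θ))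
  linarith [hmem.1, hmem.2]

theorem integrable_frame {E : Type*} [NormedAddCommGroup E] {g : ℝ × ℝ → E}
    (hc : Continuous g) (hg : HasCompactSupport g) (s θ : ℝ) :
    Integrable (fun t : ℝ => g (s • Phi θ + t • Phi (θ + π / 2))) := by
  obtain ⟨R, hR⟩ := hg.exists_eq_zero_of_frame θ
  refine Continuous.integrable_of_hasCompactSupport (by fun_prop) ?_
  refine HasCompactSupport.intro (isCompact_Icc (a := -R) (b := R)) fun t ht => hR s t ?_
  by_contra! hle
  exact ht (abs_le.mp hle)

/-- The Radon transform of the derivative of `h` along the line of integration vanishes. -/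
theorem radon_fderiv_tangent {h : ℝ × ℝ → ℝ} (hsm : ContDiff ℝ 1 h)
    (hsupp : HasCompactSupport h) (s θ : ℝ) :
    radon (fun x => fderiv ℝ h x (Phi (θ + π / 2))) s θ = 0 := by
  refine integral_eq_zero_of_hasDerivAt_of_integrable (fun t => ?_)
    (integrable_frame ((hsm.continuous_fderiv one_ne_zero).clm_apply continuous_const)
      (hsupp.fderiv_apply ℝ _) s θ)
    (integrable_frame hsm.continuous hsupp s θ)
  refine ((hsm.differentiable one_ne_zero) _).hasFDerivAt.comp_hasDerivAt t ?_
  simpa using ((hasDerivAt_id t).smul_const (Phi (θ + π / 2))).const_add (s • Phi θ)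

/-- Differentiation of the Radon transform in the offset, under the integral sign. -/
theorem hasDerivAt_radon {h : ℝ × ℝ → ℝ} (hsm : ContDiff ℝ 1 h)
    (hsupp : HasCompactSupport h) (s θ : ℝ) :
    HasDerivAt (fun s' => radon h s' θ) (radon (fun x => fderiv ℝ h x (Phi θ)) s θ) s := by
  have hcont : Continuous fun x => fderiv ℝ h x (Phi θ) :=
    (hsm.continuous_fderiv one_ne_zero).clm_apply continuous_const
  have hsupp' : HasCompactSupport fun x => fderiv ℝ h x (Phi θ) := hsupp.fderiv_apply ℝ _
  obtain ⟨C, hC⟩ := hcont.bounded_above_of_compact_support hsupp'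
  obtain ⟨R, hR⟩ := hsupp'.exists_eq_zero_of_frame θ
  have hh := hsm.continuous
  refine (hasDerivAt_integral_of_dominated_loc_of_deriv_le (μ := volume)
    (F := fun s' t => h (s' • Phi θ + t • Phi (θ + π / 2)))
    (F' := fun s' t => fderiv ℝ h (s' • Phi θ + t • Phi (θ + π / 2)) (Phi θ))
    (bound := (Icc (-R) R).indicator fun _ => C) Filter.univ_mem
    (.of_forall fun s' => Continuous.aestronglyMeasurable (by fun_prop))
    (integrable_frame hh hsupp s θ) (integrable_frame hcont hsupp' s θ).aestronglyMeasurable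
    (.of_forall fun t s' _ => ?_) ?_ (.of_forall fun t s' _ => ?_)).2
  · by_cases ht : t ∈ Icc (-R) R
    · rw [indicator_of_mem ht]
      exact hC _
    · rw [indicator_of_notMem ht, hR s' t (not_le.mp fun hle => ht (abs_le.mp hle)), norm_zero]
  · exact (integrable_indicator_iff measurableSet_Icc).mpr (by simp)
  · refine ((hsm.differentiable one_ne_zero) _).hasFDerivAt.comp_hasDerivAt s' ?_
    simpa using ((hasDerivAt_id s').smul_const (Phi θ)).add_const (t • Phi (θ + π / 2))

/-- the Radon transform intertwines partial derivatives with `∂/∂s`. -/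
theorem radon_partialDeriv (h : ℝ × ℝ → ℝ) (hsm : ContDiff ℝ (⊤ : ℕ∞) h)
    (hsupp : HasCompactSupport h) (k : Fin 2) (s θ : ℝ) :
    radon (fun x => fderiv ℝ h x (stdBasis k)) s θ =
      coord (Phi θ) k * deriv (fun s' => radon h s' θ) s := by
  have hsm1 : ContDiff ℝ 1 h := hsm.of_le (by exact_mod_cast le_top)
  have hint (v : ℝ × ℝ) :
      Integrable fun t : ℝ => fderiv ℝ h (s • Phi θ + t • Phi (θ + π / 2)) v :=
    integrable_frame ((hsm1.continuous_fderiv one_ne_zero).clm_apply continuous_const)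
      (hsupp.fderiv_apply ℝ v) s θ
  have htangent := radon_fderiv_tangent hsm1 hsupp s θ
  rw [(hasDerivAt_radon hsm1 hsupp s θ).deriv]
  unfold radon at htangent ⊢
  simp only [stdBasis_eq_frame k θ, map_add, map_smul, smul_eq_mul]
  rw [integral_add ((hint _).const_mul _) ((hint _).const_mul _), integral_const_mul,
    integral_const_mul, htangent, mul_zero, add_zero]
end
end

section
/- Let η : ℝ² → ℝ be a smooth function whose support is contained in the closed unit disk. Then the longitudinal V-line transform of the gradient field dη := (∂η/∂x₁, ∂η/∂x₂) vanishes identically: L(dη)(φ, ψ) = 0 for all (φ, ψ) ∈ [0, 2π) × (0, π/2). -/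
open Real MeasureTheory Set

noncomputable section

/-- The gradient `dV = (∂V/∂x₁, ∂V/∂x₂)` of a scalar function. -/
def grad (V : ℝ × ℝ → ℝ) (x : ℝ × ℝ) : ℝ × ℝ :=
  (fderiv ℝ V x (1, 0), fderiv ℝ V x (0, 1))

/-- The orthogonal gradient `d⊥V = (−∂V/∂x₂, ∂V/∂x₁)` of a scalar function. -/
def gradPerp (V : ℝ × ℝ → ℝ) (x : ℝ × ℝ) : ℝ × ℝ :=
  (-(fderiv ℝ V x (0, 1)), fderiv ℝ V x (1, 0))

/-- The longitudinal V-line transform of a vector field. -/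
def Lvec (f : ℝ × ℝ → ℝ × ℝ) (φ ψ : ℝ) : ℝ :=
  (∫ t in Ioi (0 : ℝ), dot (Phi (π + φ - ψ)) (f (Phi φ + t • Phi (π + φ - ψ)))) +
  (∫ t in Ioi (0 : ℝ), dot (Phi (π + φ + ψ)) (f (Phi φ + t • Phi (π + φ + ψ))))

/-- The transverse V-line transform of a vector field. -/
def Tvec (f : ℝ × ℝ → ℝ × ℝ) (φ ψ : ℝ) : ℝ :=
  (∫ t in Ioi (0 : ℝ), dot (perp (Phi (π + φ - ψ))) (f (Phi φ + t • Phi (π + φ - ψ)))) +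
  (∫ t in Ioi (0 : ℝ), dot (perp (Phi (π + φ + ψ))) (f (Phi φ + t • Phi (π + φ + ψ))))

/-- The `k`-th moment longitudinal V-line transform of a vector field. -/
def LvecMoment (k : ℕ) (f : ℝ × ℝ → ℝ × ℝ) (φ ψ : ℝ) : ℝ :=
  (∫ t in Ioi (0 : ℝ), t ^ k * dot (Phi (π + φ - ψ)) (f (Phi φ + t • Phi (π + φ - ψ)))) +
  (∫ t in Ioi (0 : ℝ), t ^ k * dot (Phi (π + φ + ψ)) (f (Phi φ + t • Phi (π + φ + ψ))))

/-- The dot product with the gradient is the directional derivative. -/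
lemma dot_grad (η : ℝ × ℝ → ℝ) (w x : ℝ × ℝ) : dot w (grad η x) = fderiv ℝ η x w := by
  have hw : w = w.1 • ((1, 0) : ℝ × ℝ) + w.2 • ((0, 1) : ℝ × ℝ) := by
    ext <;> simp
  conv_rhs => rw [hw]
  rw [map_add, map_smul, map_smul]
  simp [dot, grad]

/-- The integral of a gradient field along a ray is minus the value of the potential at the
vertex. -/
lemma integral_Ioi_dot_grad {η : ℝ × ℝ → ℝ} (hη : ContDiff ℝ 1 η) {p w : ℝ × ℝ}
    (hc : HasCompactSupport fun t : ℝ => η (p + t • w)) :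
    ∫ t in Ioi (0 : ℝ), dot w (grad η (p + t • w)) = -η p := by
  have hd : ∀ t : ℝ, deriv (fun t : ℝ => η (p + t • w)) t = dot w (grad η (p + t • w)) := by
    intro t
    have h1 : HasDerivAt (fun t : ℝ => p + t • w) w t := by
      simpa using ((hasDerivAt_id t).smul_const w).const_add p
    rw [dot_grad]
    exact ((hη.differentiable one_ne_zero _).hasFDerivAt.comp_hasDerivAt t h1).deriv
  have hs : ContDiff ℝ 1 fun t : ℝ => η (p + t • w) := by fun_prop
  simpa [hd] using hc.integral_Ioi_deriv_eq hs 0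

/-- A function supported in the closed unit disk has compact support along every line through a
point of the unit circle. -/
lemma hasCompactSupport_line {η : ℝ × ℝ → ℝ} (hsupp : Function.support η ⊆ closedUnitDisk)
    (α θ : ℝ) : HasCompactSupport fun t : ℝ => η (Phi α + t • Phi θ) := by
  refine HasCompactSupport.intro (isCompact_Icc (a := (-2 : ℝ)) (b := 2)) fun t ht => ?_
  by_contra hne
  have hmem : (cos α + t * cos θ) ^ 2 + (sin α + t * sin θ) ^ 2 ≤ 1 := hsupp hne
  have hexp : (cos α + t * cos θ) ^ 2 + (sin α + t * sin θ) ^ 2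
      = 1 + 2 * t * cos (α - θ) + t ^ 2 := by
    rw [cos_sub]
    linear_combination sin_sq_add_cos_sq α + t ^ 2 * sin_sq_add_cos_sq θ
  have h1 := neg_one_le_cos (α - θ)
  have h2 := cos_le_one (α - θ)
  apply ht
  constructor <;> by_contra! h <;> nlinarith

/-- A continuous function supported in the closed unit disk vanishes on the unit circle. -/
lemma eq_zero_of_support_subset_closedUnitDisk {η : ℝ × ℝ → ℝ} (hη : Continuous η)
    (hsupp : Function.support η ⊆ closedUnitDisk) (α : ℝ) : η (Phi α) = 0 := by
  have hz : ∀ t ∈ Ioi (1 : ℝ), η (t • Phi α) = 0 := by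
    intro t ht
    by_contra hne
    have hmem : (t * cos α) ^ 2 + (t * sin α) ^ 2 ≤ 1 := hsupp hne
    have hexp : (t * cos α) ^ 2 + (t * sin α) ^ 2 = t ^ 2 := by
      linear_combination t ^ 2 * sin_sq_add_cos_sq α
    have ht' : 1 < t := ht
    nlinarith
  have hcl : IsClosed {t : ℝ | η (t • Phi α) = 0} :=
    isClosed_eq (by fun_prop) continuous_const
  have h1 : (1 : ℝ) ∈ closure (Ioi (1 : ℝ)) := by simp
  simpa using closure_minimal (t := {t : ℝ | η (t • Phi α) = 0}) hz hcl h1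

/-- gradient fields are in the kernel of the longitudinal V-line transform. -/
theorem Lvec_grad_eq_zero (η : ℝ × ℝ → ℝ) (hsm : ContDiff ℝ (⊤ : ℕ∞) η)
    (hsupp : Function.support η ⊆ closedUnitDisk)
    (φ ψ : ℝ) (hφ : φ ∈ Ico 0 (2 * π)) (hψ : ψ ∈ Ioo 0 (π / 2)) :
    Lvec (grad η) φ ψ = 0 := by
  have hη : ContDiff ℝ 1 η := hsm.of_le (by exact_mod_cast le_top)
  rw [Lvec, integral_Ioi_dot_grad hη (hasCompactSupport_line hsupp _ _),
    integral_Ioi_dot_grad hη (hasCompactSupport_line hsupp _ _),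
    eq_zero_of_support_subset_closedUnitDisk hη.continuous hsupp]
  simp
end
end

section
/- Let χ : ℝ² → ℝ be a smooth function whose support is contained in the closed unit disk. Then the transverse V-line transform of the field d⊥χ := (−∂χ/∂x₂, ∂χ/∂x₁) vanishes identically: T(d⊥χ)(φ, ψ) = 0 for all (φ, ψ) ∈ [0, 2π) × (0, π/2). -/
open Real MeasureTheory Set

noncomputable section

lemma Phi_sq_add_sq (θ : ℝ) : (Phi θ).1 ^ 2 + (Phi θ).2 ^ 2 = 1 :=
  Real.cos_sq_add_sin_sq θ

lemma eq_zero_of_one_lt_sq_add_sq {χ : ℝ × ℝ → ℝ}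
    (hsupp : Function.support χ ⊆ closedUnitDisk) {x : ℝ × ℝ}
    (hx : 1 < x.1 ^ 2 + x.2 ^ 2) : χ x = 0 :=
  Function.notMem_support.1 fun h => not_le.2 hx (hsupp h)

/-- A continuous function supported in the closed unit disk vanishes on the unit circle. -/
lemma apply_Phi_eq_zero {χ : ℝ × ℝ → ℝ} (hc : Continuous χ)
    (hsupp : Function.support χ ⊆ closedUnitDisk) (θ : ℝ) : χ (Phi θ) = 0 := by
  have h : EqOn (fun r : ℝ => χ (r • Phi θ)) (fun _ => 0) (Ioi 1) := by
    intro r hr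
    have hr' : 1 < r := hr
    refine eq_zero_of_one_lt_sq_add_sq hsupp ?_
    have := Phi_sq_add_sq θ
    simp only [Prod.smul_fst, Prod.smul_snd, smul_eq_mul]
    rw [mul_pow, mul_pow, ← mul_add, this, mul_one]
    exact one_lt_pow₀ hr' two_ne_zero
  have h' := h.closure (by fun_prop) continuous_const
  rw [closure_Ioi] at h'
  simpa using h' (mem_Ici.2 (le_refl (1 : ℝ)))

lemma dot_perp_gradPerp (χ : ℝ × ℝ → ℝ) (w x : ℝ × ℝ) :
    dot (perp w) (gradPerp χ x) = fderiv ℝ χ x w := by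
  have hw : w = w.1 • ((1, 0) : ℝ × ℝ) + w.2 • ((0, 1) : ℝ × ℝ) := by ext <;> simp
  conv_rhs => rw [hw, map_add, map_smul, map_smul]
  simp only [dot, perp, gradPerp, smul_eq_mul]
  ring

/-- The transverse ray integral of an orthogonal gradient, along a ray issued from the unit
circle, vanishes. -/
lemma integral_Ioi_dot_perp_gradPerp_eq_zero {χ : ℝ × ℝ → ℝ} (hsm : ContDiff ℝ 1 χ)
    (hsupp : Function.support χ ⊆ closedUnitDisk) (α β : ℝ) :
    ∫ t in Ioi (0 : ℝ), dot (perp (Phi β)) (gradPerp χ (Phi α + t • Phi β)) = 0 := by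
  have hderiv (t : ℝ) : deriv (fun t : ℝ => χ (Phi α + t • Phi β)) t =
      dot (perp (Phi β)) (gradPerp χ (Phi α + t • Phi β)) := by
    rw [dot_perp_gradPerp]
    have hline : HasDerivAt (fun t : ℝ => Phi α + t • Phi β) (Phi β) t := by
      simpa using ((hasDerivAt_id t).smul_const (Phi β)).const_add (Phi α)
    exact ((hsm.differentiable one_ne_zero _).hasFDerivAt.comp_hasDerivAt t hline).deriv
  have hcpt : HasCompactSupport (fun t : ℝ => χ (Phi α + t • Phi β)) := by
    refine HasCompactSupport.intro (isCompact_Icc (a := -2) (b := 2)) fun t ht => ?_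
    refine eq_zero_of_one_lt_sq_add_sq hsupp ?_
    have hα := Phi_sq_add_sq α
    have hβ := Phi_sq_add_sq β
    simp only [Prod.fst_add, Prod.snd_add, Prod.smul_fst, Prod.smul_snd, smul_eq_mul]
    set a := (Phi α).1
    set b := (Phi α).2
    set c := (Phi β).1
    set d := (Phi β).2
    have hexp : (a + t * c) ^ 2 + (b + t * d) ^ 2 = 1 + 2 * t * (a * c + b * d) + t ^ 2 := by
      linear_combination hα + t ^ 2 * hβ
    have hle : a * c + b * d ≤ 1 := by nlinarith [sq_nonneg (a - c), sq_nonneg (b - d)]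
    have hge : -1 ≤ a * c + b * d := by nlinarith [sq_nonneg (a + c), sq_nonneg (b + d)]
    rw [hexp]
    rcases lt_or_ge t (-2) with h | h
    · nlinarith
    · have : 2 < t := by
        by_contra! h2
        exact ht ⟨h, h2⟩
      nlinarith
  have hC : ContDiff ℝ 1 (fun t : ℝ => χ (Phi α + t • Phi β)) := hsm.comp (by fun_prop)
  simp_rw [← hderiv]
  rw [hcpt.integral_Ioi_deriv_eq hC 0]
  simpa using apply_Phi_eq_zero hsm.continuous hsupp α

/-- orthogonal-gradient (solenoidal) fields are in the kernel of the transverse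
V-line transform. -/
theorem Tvec_gradPerp_eq_zero (χ : ℝ × ℝ → ℝ) (hsm : ContDiff ℝ (⊤ : ℕ∞) χ)
    (hsupp : Function.support χ ⊆ closedUnitDisk)
    (φ ψ : ℝ) (hφ : φ ∈ Ico 0 (2 * π)) (hψ : ψ ∈ Ioo 0 (π / 2)) :
    Tvec (gradPerp χ) φ ψ = 0 := by
  have h1 : ContDiff ℝ 1 χ := hsm.of_le (by exact_mod_cast le_top)
  rw [Tvec, integral_Ioi_dot_perp_gradPerp_eq_zero h1 hsupp,
    integral_Ioi_dot_perp_gradPerp_eq_zero h1 hsupp, add_zero]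
end
end

section
/- Let χ : ℝ² → ℝ be a smooth function whose support is contained in the closed unit disk. Then for every (φ, ψ) ∈ [0, 2π) × (0, π/2), the longitudinal V-line transform of the field d⊥χ := (−∂χ/∂x₂, ∂χ/∂x₁) satisfies L(d⊥χ)(φ, ψ) = (∂/∂s)[Rχ(s, φ − ψ + π/2) − Rχ(s, φ + ψ − π/2)] evaluated at s = sin ψ. -/
open Real MeasureTheory Set

noncomputable section

/-- The frame `Phi θ`, `Phi (θ + π / 2)` is orthonormal. -/
theorem normSq_smul_Phi_add (s t θ : ℝ) :
    (s • Phi θ + t • Phi (θ + π / 2)).1 ^ 2 + (s • Phi θ + t • Phi (θ + π / 2)).2 ^ 2 =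
      s ^ 2 + t ^ 2 := by
  simp only [Phi, Prod.smul_mk, Prod.mk_add_mk, smul_eq_mul, Real.cos_add_pi_div_two,
    Real.sin_add_pi_div_two]
  linear_combination (s ^ 2 + t ^ 2) * Real.sin_sq_add_cos_sq θ

theorem isClosed_closedUnitDisk : IsClosed closedUnitDisk :=
  isClosed_le (by fun_prop) continuous_const

theorem isCompact_closedUnitDisk : IsCompact closedUnitDisk := by
  refine ((isCompact_Icc (a := (-1 : ℝ)) (b := 1)).prod
    (isCompact_Icc (a := (-1 : ℝ)) (b := 1))).of_isClosed_subset isClosed_closedUnitDisk ?_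
  intro x hx
  simp only [closedUnitDisk, mem_ofPred_eq] at hx
  refine ⟨⟨?_, ?_⟩, ⟨?_, ?_⟩⟩ <;> nlinarith [sq_nonneg x.1, sq_nonneg x.2]

theorem fderiv_eq_zero_of_one_lt {χ : ℝ × ℝ → ℝ} (hsupp : Function.support χ ⊆ closedUnitDisk)
    {x : ℝ × ℝ} (hx : 1 < x.1 ^ 2 + x.2 ^ 2) : fderiv ℝ χ x = 0 := by
  by_contra h
  have hmem : x ∈ closedUnitDisk :=
    closure_minimal hsupp isClosed_closedUnitDisk (support_fderiv_subset ℝ h)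
  exact absurd hx (not_lt.mpr hmem)

/-- The Radon transform may be differentiated in `s` under the integral sign. -/
theorem hasDerivAt_radon_s9 {χ : ℝ × ℝ → ℝ} (hχ : ContDiff ℝ 1 χ)
    (hsupp : Function.support χ ⊆ closedUnitDisk) (s θ : ℝ) :
    HasDerivAt (fun s => radon χ s θ)
      (∫ t : ℝ, fderiv ℝ χ (s • Phi θ + t • Phi (θ + π / 2)) (Phi θ)) s := by
  have hcont : Continuous fun x => fderiv ℝ χ x (Phi θ) :=
    (hχ.continuous_fderiv one_ne_zero).clm_apply continuous_const
  obtain ⟨C, hC⟩ := isCompact_closedUnitDisk.exists_bound_of_continuousOn hcont.continuousOn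
  have hout : ∀ (r t : ℝ), t ∉ Icc (-1 : ℝ) 1 →
      1 < (r • Phi θ + t • Phi (θ + π / 2)).1 ^ 2 +
        (r • Phi θ + t • Phi (θ + π / 2)).2 ^ 2 := by
    intro r t ht
    rw [normSq_smul_Phi_add]
    have : 1 < t ^ 2 := by
      rw [mem_Icc, ← abs_le, not_le] at ht
      rwa [one_lt_sq_iff_one_lt_abs]
    nlinarith [sq_nonneg r]
  refine (hasDerivAt_integral_of_dominated_loc_of_deriv_le (μ := volume)
    (F := fun r t => χ (r • Phi θ + t • Phi (θ + π / 2)))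
    (F' := fun r t => fderiv ℝ χ (r • Phi θ + t • Phi (θ + π / 2)) (Phi θ))
    (bound := (Icc (-1 : ℝ) 1).indicator fun _ => C) (s := univ) Filter.univ_mem
    ?_ ?_ ?_ ?_ ?_ ?_).2
  · exact .of_forall fun r => (hχ.continuous.comp (by fun_prop)).aestronglyMeasurable
  · refine (hχ.continuous.comp (by fun_prop)).integrable_of_hasCompactSupport
      (HasCompactSupport.intro (isCompact_Icc (a := (-1 : ℝ)) (b := 1)) fun t ht => ?_)
    by_contra h
    exact absurd (hout s t ht) (not_lt.mpr (hsupp h))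
  · exact (hcont.comp (by fun_prop : Continuous fun t : ℝ =>
      s • Phi θ + t • Phi (θ + π / 2))).aestronglyMeasurable
  · refine .of_forall fun t r _ => ?_
    by_cases hmem : r • Phi θ + t • Phi (θ + π / 2) ∈ closedUnitDisk
    · have ht : t ∈ Icc (-1 : ℝ) 1 := by
        by_contra ht
        exact absurd (hout r t ht) (not_lt.mpr hmem)
      rw [indicator_of_mem ht]
      exact hC _ hmem
    · rw [fderiv_eq_zero_of_one_lt hsupp (not_le.mp hmem)]
      simp only [zero_apply, norm_zero]
      refine indicator_nonneg (fun _ _ => ?_) t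
      exact (norm_nonneg _).trans (hC 0 (by simp [closedUnitDisk]))
  · exact (integrable_indicator_iff measurableSet_Icc).mpr
      (integrableOn_const (by simp))
  · refine .of_forall fun t r _ => ?_
    have hline : HasDerivAt (fun r : ℝ => r • Phi θ + t • Phi (θ + π / 2)) (Phi θ) r := by
      simpa using ((hasDerivAt_id r).smul_const (Phi θ)).add_const (t • Phi (θ + π / 2))
    exact ((hχ.differentiable one_ne_zero) _).hasFDerivAt.comp_hasDerivAt r hline

theorem radon_add_pi (h : ℝ × ℝ → ℝ) (s θ : ℝ) : radon h s (θ + π) = radon h (-s) θ := by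
  unfold radon
  rw [← integral_neg_eq_self]
  congr 1 with t
  congr 1
  ext <;> simp [Phi, Real.cos_add, Real.sin_add]

theorem dot_gradPerp (V : ℝ × ℝ → ℝ) (x : ℝ × ℝ) (α : ℝ) :
    dot (Phi α) (gradPerp V x) = fderiv ℝ V x (Phi (α - π / 2)) := by
  have hPhi : Phi (α - π / 2) =
      Real.sin α • ((1 : ℝ), (0 : ℝ)) - Real.cos α • ((0 : ℝ), (1 : ℝ)) := by
    ext <;> simp [Phi, Real.cos_sub_pi_div_two, Real.sin_sub_pi_div_two]
  rw [hPhi, map_sub, map_smul, map_smul]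
  simp only [dot, gradPerp, Phi, smul_eq_mul]
  ring

theorem Phi_eq_smul_add_smul (φ θ : ℝ) :
    Phi φ = Real.cos (φ - θ) • Phi θ + Real.sin (φ - θ) • Phi (θ + π / 2) := by
  have hsq := Real.sin_sq_add_cos_sq θ
  ext <;> simp only [Phi, Prod.smul_mk, Prod.mk_add_mk, smul_eq_mul, Real.cos_add_pi_div_two,
    Real.sin_add_pi_div_two, Real.cos_sub, Real.sin_sub]
  · linear_combination (-Real.cos φ) * hsq
  · linear_combination (-Real.sin φ) * hsq

/-- The longitudinal ray transform of `d⊥χ` along the ray from `Phi φ` entering the disk in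
direction `Phi α` is the `s`-derivative of the Radon transform of `χ` along its line. -/
theorem hasDerivAt_radon_ray {χ : ℝ × ℝ → ℝ} (hχ : ContDiff ℝ 1 χ)
    (hsupp : Function.support χ ⊆ closedUnitDisk) (φ α : ℝ) (hα : Real.cos (α - φ) ≤ 0) :
    HasDerivAt (fun s => radon χ s (α - π / 2))
      (∫ t in Ioi (0 : ℝ), dot (Phi α) (gradPerp χ (Phi φ + t • Phi α)))
      (Real.sin (α - φ)) := by
  have hPhi : Phi φ = Real.sin (α - φ) • Phi (α - π / 2) + Real.cos (α - φ) • Phi α := by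
    have h := Phi_eq_smul_add_smul φ (α - π / 2)
    rwa [sub_add_cancel, show φ - (α - π / 2) = π / 2 - (α - φ) by ring,
      Real.cos_pi_div_two_sub, Real.sin_pi_div_two_sub] at h
  have hpt : ∀ t : ℝ, Phi φ + t • Phi α =
      Real.sin (α - φ) • Phi (α - π / 2) + (t + Real.cos (α - φ)) • Phi α := by
    intro t
    rw [hPhi]
    module
  convert hasDerivAt_radon_s9 hχ hsupp (Real.sin (α - φ)) (α - π / 2) using 1
  simp only [dot_gradPerp, sub_add_cancel, hpt]
  rw [← integral_Ici_eq_integral_Ioi, setIntegral_eq_integral_of_forall_compl_eq_zero]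
  · exact integral_add_right_eq_self (μ := volume) (fun t : ℝ => fderiv ℝ χ
      (Real.sin (α - φ) • Phi (α - π / 2) + t • Phi α) (Phi (α - π / 2))) (Real.cos (α - φ))
  · intro t ht
    rw [mem_Ici, not_le] at ht
    have hsq := normSq_smul_Phi_add (Real.sin (α - φ)) (t + Real.cos (α - φ)) (α - π / 2)
    rw [sub_add_cancel] at hsq
    rw [fderiv_eq_zero_of_one_lt hsupp, zero_apply]
    rw [hsq]
    nlinarith [Real.sin_sq_add_cos_sq (α - φ), mul_nonneg_of_nonpos_of_nonpos ht.le hα]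

/-- the longitudinal V-line transform of `d⊥χ` via the Radon transform of `χ`. -/
theorem Lvec_gradPerp_eq (χ : ℝ × ℝ → ℝ) (hsm : ContDiff ℝ (⊤ : ℕ∞) χ)
    (hsupp : Function.support χ ⊆ closedUnitDisk)
    (φ ψ : ℝ) (hφ : φ ∈ Ico 0 (2 * π)) (hψ : ψ ∈ Ioo 0 (π / 2)) :
    Lvec (gradPerp χ) φ ψ =
      deriv (fun s => radon χ s (φ - ψ + π / 2) - radon χ s (φ + ψ - π / 2)) (Real.sin ψ) := by
  have hχ : ContDiff ℝ 1 χ := hsm.of_le (by exact_mod_cast le_top)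
  have hcos : 0 ≤ Real.cos ψ := Real.cos_nonneg_of_mem_Icc ⟨by linarith [hψ.1, pi_pos], hψ.2.le⟩
  have hfst := hasDerivAt_radon_ray hχ hsupp φ (π + φ - ψ) (by
    rw [show π + φ - ψ - φ = π - ψ by ring, Real.cos_pi_sub]
    linarith)
  have hsnd := hasDerivAt_radon_ray hχ hsupp φ (π + φ + ψ) (by
    rw [show π + φ + ψ - φ = ψ + π by ring, Real.cos_add_pi]
    linarith)
  rw [show π + φ - ψ - φ = π - ψ by ring, Real.sin_pi_sub,
    show π + φ - ψ - π / 2 = φ - ψ + π / 2 by ring] at hfst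
  rw [show π + φ + ψ - φ = ψ + π by ring, Real.sin_add_pi,
    show π + φ + ψ - π / 2 = φ + ψ - π / 2 + π by ring] at hsnd
  simp only [radon_add_pi] at hsnd
  have hneg := hsnd.comp (Real.sin ψ) (hasDerivAt_neg (Real.sin ψ))
  simp only [Function.comp_def, neg_neg] at hneg
  rw [(hfst.fun_sub hneg).deriv, Lvec]
  ring
end
end
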